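/- arXiv:1511.00026 — 2 statements merged into one kernel-verified Lean document; each statement's English description precedes it below -/
import Mathlib

section
/- Let d=1 and a≡2 (constant). For any x_0,x_1∈ℝ and any 0≤t_0<t_1≤T, there exists S∈𝒮_a, i.e., a continuous function S:[0,T]→ℝ whose quadratic variation along (𝕋_n) exists and satisfies ⟨S,S⟩(t)=2t for all t∈[0,T], such that S(t_0)=x_0 and S(t_1)=x_1. -/
open Finset Filter Topology Set

noncomputable section

/-- The successor `s'` of `s` in the partition `P` of `[0,T]` (equal to `T` if there is none). -/
def succOf (T : ℝ) (P : Finset ℝ) (s : ℝ) : ℝ :=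
  if h : (P.filter (fun u => s < u)).Nonempty then (P.filter (fun u => s < u)).min' h else T

/-- A refining sequence of partitions of `[0,T]` whose meshes tend to zero. -/
structure PartitionSeq (T : ℝ) where
  part : ℕ → Finset ℝ
  subset_Icc : ∀ n, ↑(part n) ⊆ Set.Icc (0 : ℝ) T
  zero_mem : ∀ n, (0 : ℝ) ∈ part n
  top_mem : ∀ n, T ∈ part n
  refining : ∀ n, part n ⊆ part (n + 1)
  mesh_to_zero : ∀ ε > 0, ∃ N, ∀ n ≥ N, ∀ s ∈ part n, succOf T (part n) s - s < ε

/-- `P` is a finite subset of `[0,T]` containing both end points. -/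
structure IsPartition (T : ℝ) (P : Finset ℝ) : Prop where
  zero_mem : (0 : ℝ) ∈ P
  top_mem : T ∈ P
  subset_Icc : ↑P ⊆ Set.Icc (0 : ℝ) T

/-- The sum of squared increments of `f` over the cells of `P` starting in `[a, b)`. -/
def sqSum (T : ℝ) (P : Finset ℝ) (f : ℝ → ℝ) (a b : ℝ) : ℝ :=
  ∑ s ∈ P.filter (fun s => a ≤ s ∧ s < b), (f (succOf T P s) - f s) ^ 2

/-- `f` is constant on every half-open cell of `P`. -/
def IsStepOn (T : ℝ) (P : Finset ℝ) (f : ℝ → ℝ) : Prop :=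
  ∀ s ∈ P, ∀ x, s ≤ x → x < succOf T P s → f x = f s

namespace IsPartition

variable {T : ℝ} {P Q : Finset ℝ}

theorem nonneg (hP : IsPartition T P) {s : ℝ} (hs : s ∈ P) : 0 ≤ s := (hP.subset_Icc hs).1

theorem le_top (hP : IsPartition T P) {s : ℝ} (hs : s ∈ P) : s ≤ T := (hP.subset_Icc hs).2

theorem succOf_mem (hP : IsPartition T P) (s : ℝ) : succOf T P s ∈ P := by
  unfold succOf
  split_ifs with h
  · exact (Finset.mem_filter.1 (Finset.min'_mem _ h)).1
  · exact hP.top_mem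

theorem lt_succOf (hP : IsPartition T P) {s : ℝ} (h : s < T) : s < succOf T P s := by
  have hne : (P.filter (fun u => s < u)).Nonempty :=
    ⟨T, Finset.mem_filter.2 ⟨hP.top_mem, h⟩⟩
  unfold succOf
  rw [dif_pos hne]
  exact (Finset.mem_filter.1 (Finset.min'_mem _ hne)).2

theorem succOf_top (hP : IsPartition T P) : succOf T P T = T := by
  unfold succOf
  rw [dif_neg]
  rintro ⟨u, hu⟩
  rw [Finset.mem_filter] at hu
  exact absurd (hP.le_top hu.1) (not_le.2 hu.2)

theorem le_succOf (hP : IsPartition T P) {s : ℝ} (hs : s ∈ P) : s ≤ succOf T P s := by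
  rcases (hP.le_top hs).lt_or_eq with h | rfl
  · exact (hP.lt_succOf h).le
  · exact hP.succOf_top.ge

end IsPartition

theorem succOf_le {T : ℝ} {P : Finset ℝ} {s u : ℝ} (hu : u ∈ P) (h : s < u) :
    succOf T P s ≤ u := by
  have hm : u ∈ P.filter (fun u => s < u) := Finset.mem_filter.2 ⟨hu, h⟩
  unfold succOf
  rw [dif_pos ⟨u, hm⟩]
  exact Finset.min'_le _ _ hm

namespace IsPartition

variable {T : ℝ} {P Q : Finset ℝ}

theorem exists_floor (hP : IsPartition T P) {x : ℝ} (h0 : 0 ≤ x) (hT : x < T) :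
    ∃ s ∈ P, s ≤ x ∧ x < succOf T P s := by
  have hne : (P.filter (fun u => u ≤ x)).Nonempty :=
    ⟨0, Finset.mem_filter.2 ⟨hP.zero_mem, h0⟩⟩
  obtain ⟨hm, hle⟩ := Finset.mem_filter.1 (Finset.max'_mem _ hne)
  refine ⟨_, hm, hle, ?_⟩
  by_contra! hcon
  have := Finset.le_max' (P.filter (fun u => u ≤ x)) _
    (Finset.mem_filter.2 ⟨hP.succOf_mem _, hcon⟩)
  exact absurd (hP.lt_succOf (hle.trans_lt hT)) (not_lt.2 this)

theorem exists_pred (hP : IsPartition T P) {x : ℝ} (hx : x ∈ P) (h0 : 0 < x) :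
    ∃ s ∈ P, s < x ∧ succOf T P s = x := by
  have hne : (P.filter (fun u => u < x)).Nonempty :=
    ⟨0, Finset.mem_filter.2 ⟨hP.zero_mem, h0⟩⟩
  obtain ⟨hm, hlt⟩ := Finset.mem_filter.1 (Finset.max'_mem _ hne)
  refine ⟨_, hm, hlt, (succOf_le hx hlt).antisymm ?_⟩
  by_contra! hcon
  have := Finset.le_max' (P.filter (fun u => u < x)) _
    (Finset.mem_filter.2 ⟨hP.succOf_mem _, hcon⟩)
  exact absurd (hP.lt_succOf (hlt.trans_le (hP.le_top hx))) (not_lt.2 this)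

/-- Induction along the points of a partition, from left to right, starting at `a`. -/
theorem induction_from (hP : IsPartition T P) {a : ℝ} (ha : a ∈ P) {p : ℝ → Prop}
    (base : p a)
    (step : ∀ s ∈ P, a ≤ s → s < T → p s → p (succOf T P s)) :
    ∀ b ∈ P, a ≤ b → p b := by
  have key : ∀ k : ℕ, ∀ b ∈ P, (P.filter (fun u => u < b)).card = k → a ≤ b → p b := by
    intro k
    induction k using Nat.strong_induction_on with
    | _ k ih =>
      intro b hb hk hab
      rcases hab.eq_or_lt with rfl | hab
      · exact base
      obtain ⟨s, hs, hsb, rfl⟩ := hP.exists_pred hb ((hP.nonneg ha).trans_lt hab)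
      have has : a ≤ s := by
        by_contra! h
        exact absurd (succOf_le (T := T) ha h) (not_le.2 hab)
      refine step s hs has (hsb.trans_le (hP.le_top hb)) (ih _ ?_ s hs rfl has)
      rw [← hk]
      refine Finset.card_lt_card (Finset.ssubset_iff_subset_ne.2 ⟨fun u hu => ?_, fun h => ?_⟩)
      · rw [Finset.mem_filter] at hu ⊢
        exact ⟨hu.1, hu.2.trans hsb⟩
      · have : s ∈ P.filter (fun u => u < s) := by
          rw [h]
          exact Finset.mem_filter.2 ⟨hs, hsb⟩
        exact lt_irrefl _ (Finset.mem_filter.1 this).2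
  exact fun b hb hab => key _ b hb rfl hab

theorem filter_succOf (hP : IsPartition T P) {a s : ℝ} (hs : s ∈ P) (has : a ≤ s) (hsT : s < T) :
    P.filter (fun u => a ≤ u ∧ u < succOf T P s) =
      insert s (P.filter (fun u => a ≤ u ∧ u < s)) := by
  ext u
  simp only [Finset.mem_filter, Finset.mem_insert]
  constructor
  · rintro ⟨hu, hau, hus⟩
    rcases lt_trichotomy u s with h | h | h
    · exact Or.inr ⟨hu, hau, h⟩
    · exact Or.inl h
    · exact absurd (succOf_le (T := T) hu h) (not_le.2 hus)
  · rintro (rfl | ⟨hu, hau, hus⟩)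
    · exact ⟨hs, has, hP.lt_succOf hsT⟩
    · exact ⟨hu, hau, hus.trans (hP.lt_succOf hsT)⟩

theorem sum_succOf (hP : IsPartition T P) {a s : ℝ} (hs : s ∈ P) (has : a ≤ s) (hsT : s < T)
    (φ : ℝ → ℝ) :
    ∑ u ∈ P.filter (fun u => a ≤ u ∧ u < succOf T P s), φ u =
      φ s + ∑ u ∈ P.filter (fun u => a ≤ u ∧ u < s), φ u := by
  rw [hP.filter_succOf hs has hsT, Finset.sum_insert]
  simp

theorem sum_sub_telescope (hP : IsPartition T P) (φ : ℝ → ℝ) {a b : ℝ} (ha : a ∈ P) (hb : b ∈ P)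
    (hab : a ≤ b) :
    ∑ s ∈ P.filter (fun s => a ≤ s ∧ s < b), (φ (succOf T P s) - φ s) = φ b - φ a := by
  refine hP.induction_from ha (p := fun b => ∑ s ∈ P.filter (fun s => a ≤ s ∧ s < b),
    (φ (succOf T P s) - φ s) = φ b - φ a) ?_ ?_ b hb hab
  · rw [Finset.filter_false_of_mem, Finset.sum_empty, sub_self]
    exact fun x _ h => absurd h.2 (not_lt.2 h.1)
  · intro s hs has hsT ih
    rw [hP.sum_succOf hs has hsT (fun s => φ (succOf T P s) - φ s), ih]
    ring

end IsPartition

section SqSum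

variable {T : ℝ} {P Q : Finset ℝ} {f g : ℝ → ℝ} {a b c : ℝ}

theorem sqSum_nonneg : 0 ≤ sqSum T P f a b := Finset.sum_nonneg fun _ _ => sq_nonneg _

theorem sqSum_self : sqSum T P f a a = 0 := by
  unfold sqSum
  rw [Finset.filter_false_of_mem, Finset.sum_empty]
  exact fun x _ h => absurd h.2 (not_lt.2 h.1)

theorem sqSum_add (hab : a ≤ b) (hbc : b ≤ c) :
    sqSum T P f a b + sqSum T P f b c = sqSum T P f a c := by
  unfold sqSum
  rw [← Finset.sum_union]
  · congr 1
    ext s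
    simp only [Finset.mem_union, Finset.mem_filter]
    constructor
    · rintro (⟨h, h1, h2⟩ | ⟨h, h1, h2⟩)
      · exact ⟨h, h1, h2.trans_le hbc⟩
      · exact ⟨h, hab.trans h1, h2⟩
    · rintro ⟨h, h1, h2⟩
      rcases lt_or_ge s b with h3 | h3
      · exact Or.inl ⟨h, h1, h3⟩
      · exact Or.inr ⟨h, h3, h2⟩
  · refine Finset.disjoint_left.2 fun s h1 h2 => ?_
    exact absurd (Finset.mem_filter.1 h1).2.2 (not_lt.2 (Finset.mem_filter.1 h2).2.1)

theorem sqSum_congr (hP : IsPartition T P) (hb : b ∈ P)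
    (h : ∀ x ∈ P, a ≤ x → x ≤ b → f x = g x) : sqSum T P f a b = sqSum T P g a b := by
  refine Finset.sum_congr rfl fun s hs => ?_
  obtain ⟨hs, has, hsb⟩ := Finset.mem_filter.1 hs
  rw [h s hs has hsb.le, h _ (hP.succOf_mem s) (has.trans (hP.le_succOf hs)) (succOf_le hb hsb)]

theorem sqSum_le_of_le (hP : IsPartition T P) (φ : ℝ → ℝ) (ha : a ∈ P) (hb : b ∈ P) (hab : a ≤ b)
    (h : ∀ s ∈ P, a ≤ s → s < b → (f (succOf T P s) - f s) ^ 2 ≤ φ (succOf T P s) - φ s) :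
    sqSum T P f a b ≤ φ b - φ a := by
  rw [← hP.sum_sub_telescope φ ha hb hab]
  refine Finset.sum_le_sum fun s hs => ?_
  obtain ⟨hs, has, hsb⟩ := Finset.mem_filter.1 hs
  exact h s hs has hsb

theorem sqSum_eq_of_eq (hP : IsPartition T P) (φ : ℝ → ℝ) (ha : a ∈ P) (hb : b ∈ P) (hab : a ≤ b)
    (h : ∀ s ∈ P, a ≤ s → s < b → (f (succOf T P s) - f s) ^ 2 = φ (succOf T P s) - φ s) :
    sqSum T P f a b = φ b - φ a := by
  rw [← hP.sum_sub_telescope φ ha hb hab]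
  refine Finset.sum_congr rfl fun s hs => ?_
  obtain ⟨hs, has, hsb⟩ := Finset.mem_filter.1 hs
  exact h s hs has hsb

theorem sqSum_cell (hP : IsPartition T P) (ha : a ∈ P) (haT : a < T) :
    sqSum T P f a (succOf T P a) = (f (succOf T P a) - f a) ^ 2 := by
  have h := hP.sum_succOf ha le_rfl haT (fun s => (f (succOf T P s) - f s) ^ 2)
  have h0 := sqSum_self (T := T) (P := P) (f := f) (a := a)
  unfold sqSum at h0 ⊢
  rw [h, h0, add_zero]

/-- A cell of a refinement lies in a cell of the coarser partition. -/
theorem exists_coarse_cell (hP : IsPartition T P) (hQ : IsPartition T Q) (hPQ : P ⊆ Q) {s : ℝ}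
    (hs : s ∈ Q) (hsT : s < T) :
    ∃ p ∈ P, p ≤ s ∧ s < succOf T P p ∧ succOf T Q s ≤ succOf T P p := by
  obtain ⟨p, hp, hps, hsp⟩ := hP.exists_floor (hQ.nonneg hs) hsT
  exact ⟨p, hp, hps, hsp, succOf_le (hPQ (hP.succOf_mem p)) hsp⟩

theorem IsStepOn.mono (hf : IsStepOn T P f) (hP : IsPartition T P) (hQ : IsPartition T Q)
    (hPQ : P ⊆ Q) : IsStepOn T Q f := by
  intro s hs x hsx hxs
  have hsT : s < T := hsx.trans_lt (hxs.trans_le (hQ.le_top (hQ.succOf_mem s)))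
  obtain ⟨p, hp, hps, hsp, hle⟩ := exists_coarse_cell hP hQ hPQ hs hsT
  rw [hf p hp x (hps.trans hsx) (hxs.trans_le hle), hf p hp s hps hsp]

/-- Along a refinement, a step function has the same sums of squared increments. -/
theorem IsStepOn.sqSum_eq (hf : IsStepOn T P f) (hP : IsPartition T P) (hQ : IsPartition T Q)
    (hPQ : P ⊆ Q) (ha : a ∈ P) (hb : b ∈ P) (hab : a ≤ b) :
    sqSum T Q f a b = sqSum T P f a b := by
  refine hP.induction_from ha (p := fun b => sqSum T Q f a b = sqSum T P f a b) ?_ ?_ b hb hab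
  · rw [sqSum_self, sqSum_self]
  · intro s hs has hsT ih
    have hss := hP.lt_succOf hsT
    rw [← sqSum_add has hss.le, ← sqSum_add has hss.le, ih, sqSum_cell hP hs hsT]
    congr 1
    obtain ⟨p, hp, hlt, heq⟩ :=
      hQ.exists_pred (hPQ (hP.succOf_mem s)) ((hP.nonneg hs).trans_lt hss)
    have hsp : s ≤ p := by
      by_contra! h
      exact absurd (succOf_le (T := T) (hPQ hs) h) (not_le.2 (heq ▸ hss))
    unfold sqSum
    rw [Finset.sum_eq_single p]
    · rw [heq, hf s hs p hsp hlt]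
    · intro u hu hup
      obtain ⟨hu, hsu, hus⟩ := Finset.mem_filter.1 hu
      have hup : u < p := by
        refine lt_of_le_of_ne ?_ hup
        by_contra! h
        exact absurd (succOf_le (T := T) hu h) (not_le.2 (heq ▸ hus))
      rw [hf s hs u hsu hus, hf s hs _ (hsu.trans (hQ.le_succOf hu))
        ((succOf_le hp hup).trans_lt hlt)]
      ring
    · intro h
      exact absurd (Finset.mem_filter.2 ⟨hp, hsp, hlt⟩) h

/-- Along a refinement, the increments of a step function do not become larger. -/
theorem IsStepOn.abs_sub_le (hf : IsStepOn T P f) (hP : IsPartition T P) (hQ : IsPartition T Q)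
    (hPQ : P ⊆ Q) {ε : ℝ} (hε : 0 ≤ ε) {s : ℝ} (hs : s ∈ Q) (hsT : s < T)
    (h : ∀ p ∈ P, p ≤ s → |f (succOf T P p) - f p| ≤ ε) : |f (succOf T Q s) - f s| ≤ ε := by
  obtain ⟨p, hp, hps, hsp, hle⟩ := exists_coarse_cell hP hQ hPQ hs hsT
  rw [hf p hp s hps hsp]
  rcases hle.lt_or_eq with hlt | heq
  · rw [hf p hp _ (hps.trans (hQ.le_succOf hs)) hlt]
    simpa using hε
  · rw [heq]
    exact h p hp hps

end SqSum

namespace PartitionSeq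

variable {T : ℝ} (𝕋 : PartitionSeq T)

theorem isPartition (n : ℕ) : IsPartition T (𝕋.part n) :=
  ⟨𝕋.zero_mem n, 𝕋.top_mem n, 𝕋.subset_Icc n⟩

theorem part_mono : Monotone 𝕋.part := monotone_nat_of_le_succ 𝕋.refining

theorem exists_mem_Ioo {α β : ℝ} (h0 : 0 ≤ α) (hαβ : α < β) (hT : β ≤ T) :
    ∃ n, ∃ y ∈ 𝕋.part n, α < y ∧ y < β := by
  obtain ⟨n, hn⟩ := 𝕋.mesh_to_zero (β - α) (sub_pos.2 hαβ)
  obtain ⟨s, hs, hsα, hαs⟩ := (𝕋.isPartition n).exists_floor h0 (hαβ.trans_le hT)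
  have := hn n le_rfl s hs
  exact ⟨n, _, (𝕋.isPartition n).succOf_mem s, hαs, by linarith⟩

theorem exists_subset_Ioo_card (L : ℕ) {α β : ℝ} (h0 : 0 ≤ α) (hαβ : α < β) (hT : β ≤ T) :
    ∃ n, ∃ Y ⊆ 𝕋.part n, (∀ y ∈ Y, α < y ∧ y < β) ∧ Y.card = L := by
  induction L generalizing β with
  | zero => exact ⟨0, ∅, by simp, by simp, rfl⟩
  | succ L ih =>
    have h1 : α < (α + β) / 2 := by linarith
    have h2 : (α + β) / 2 < β := by linarith
    obtain ⟨n, Y, hY, hYm, hc⟩ := ih h1 (h2.le.trans hT)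
    obtain ⟨k, y, hy, hy1, hy2⟩ := 𝕋.exists_mem_Ioo (h0.trans h1.le) h2 hT
    refine ⟨max n k, insert y Y, ?_, ?_, ?_⟩
    · refine Finset.insert_subset (𝕋.part_mono (le_max_right n k) hy)
        (hY.trans (𝕋.part_mono (le_max_left n k)))
    · intro z hz
      rcases Finset.mem_insert.1 hz with rfl | hz
      · exact ⟨h1.trans hy1, hy2⟩
      · exact ⟨(hYm z hz).1, (hYm z hz).2.trans h2⟩
    · rw [Finset.card_insert_of_notMem, hc]
      exact fun hmem => absurd (hYm y hmem).2 (not_lt.2 hy1.le)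

end PartitionSeq

/-- The path with slope `d` whose odd values are raised by `σ`. -/
def zigzag (d σ : ℝ) (i : ℕ) : ℝ := d * i + σ * (i % 2 : ℕ)

section Zigzag

variable {d σ : ℝ}

theorem zigzag_zero : zigzag d σ 0 = 0 := by simp [zigzag]

theorem zigzag_two_mul (l : ℕ) : zigzag d σ (2 * l) = d * (2 * l : ℕ) := by simp [zigzag]

theorem sum_sq_zigzag (l : ℕ) :
    ∑ i ∈ Finset.range (2 * l), (zigzag d σ (i + 1) - zigzag d σ i) ^ 2 =
      (2 * l : ℕ) * (d ^ 2 + σ ^ 2) := by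
  induction l with
  | zero => simp
  | succ l ih =>
    rw [show 2 * (l + 1) = 2 * l + 1 + 1 by ring, Finset.sum_range_succ, Finset.sum_range_succ, ih]
    have h1 : (2 * l + 1) % 2 = 1 := by omega
    have h2 : (2 * l + 1 + 1) % 2 = 0 := by omega
    have h3 : (2 * l) % 2 = 0 := by omega
    simp only [zigzag, h1, h2, h3]
    push_cast
    ring

theorem mod_two_cast_mem (i : ℕ) : 0 ≤ ((i % 2 : ℕ) : ℝ) ∧ ((i % 2 : ℕ) : ℝ) ≤ 1 :=
  ⟨Nat.cast_nonneg _, by exact_mod_cast Nat.le_of_lt_succ (Nat.mod_lt i two_pos)⟩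

theorem abs_zigzag_le (hσ : 0 ≤ σ) {i L : ℕ} (h : i ≤ L) :
    |zigzag d σ i| ≤ |d * L| + σ := by
  unfold zigzag
  obtain ⟨h0, h1⟩ := mod_two_cast_mem i
  refine (abs_add_le _ _).trans (add_le_add ?_ ?_)
  · rw [abs_mul, abs_mul, Nat.abs_cast, Nat.abs_cast]
    exact mul_le_mul_of_nonneg_left (by exact_mod_cast h) (abs_nonneg _)
  · rw [abs_mul, abs_of_nonneg hσ, abs_of_nonneg h0]
    exact mul_le_of_le_one_right hσ h1

theorem abs_zigzag_succ_sub_le (hσ : 0 ≤ σ) (i : ℕ) :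
    |zigzag d σ (i + 1) - zigzag d σ i| ≤ |d| + σ := by
  unfold zigzag
  obtain ⟨h0, h1⟩ := mod_two_cast_mem i
  obtain ⟨h2, h3⟩ := mod_two_cast_mem (i + 1)
  have : d * ((i + 1 : ℕ) : ℝ) + σ * ((i + 1) % 2 : ℕ) - (d * i + σ * (i % 2 : ℕ)) =
      d + σ * (((i + 1) % 2 : ℕ) - (i % 2 : ℕ)) := by
    push_cast
    ring
  rw [this]
  refine (abs_add_le _ _).trans (add_le_add le_rfl ?_)
  rw [abs_mul, abs_of_nonneg hσ]
  exact mul_le_of_le_one_right hσ (abs_le.2 ⟨by linarith, by linarith⟩)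

theorem sq_zigzag_sub_le {i j L : ℕ} (hij : i ≤ j) (hj : j ≤ L) :
    (zigzag d σ j - zigzag d σ i) ^ 2 ≤ 2 * (d ^ 2 * L + σ ^ 2) * (j - i) := by
  rcases hij.eq_or_lt with rfl | hij
  · simp
  unfold zigzag
  obtain ⟨h0, h1⟩ := mod_two_cast_mem i
  obtain ⟨h2, h3⟩ := mod_two_cast_mem j
  have hk1 : (1 : ℝ) ≤ j - i := by
    have : ((i + 1 : ℕ) : ℝ) ≤ j := by exact_mod_cast hij
    push_cast at this
    linarith
  have hkL : (j : ℝ) - i ≤ L := by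
    have : (j : ℝ) ≤ L := by exact_mod_cast hj
    have : (0 : ℝ) ≤ i := Nat.cast_nonneg i
    linarith
  set k : ℝ := j - i with hk
  set w : ℝ := (j % 2 : ℕ) - (i % 2 : ℕ) with hw
  have e : d * (j : ℝ) + σ * (j % 2 : ℕ) - (d * i + σ * (i % 2 : ℕ)) = d * k + σ * w := by
    rw [hk, hw]
    ring
  have hw2 : w ^ 2 ≤ k := by
    have : w ^ 2 ≤ 1 := by
      rw [sq_le_one_iff_abs_le_one, abs_le]
      exact ⟨by linarith, by linarith⟩
    linarith
  have hk2 : k ^ 2 ≤ L * k := by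
    rw [sq]
    exact mul_le_mul_of_nonneg_right hkL (by linarith)
  rw [e]
  have e1 : (d * k + σ * w) ^ 2 ≤ 2 * (d ^ 2 * k ^ 2 + σ ^ 2 * w ^ 2) := by
    nlinarith [sq_nonneg (d * k - σ * w)]
  have e2 := mul_le_mul_of_nonneg_left hk2 (sq_nonneg d)
  have e3 := mul_le_mul_of_nonneg_left hw2 (sq_nonneg σ)
  nlinarith

end Zigzag

/-- A step function can be modified inside one cell so that, along a later partition, the cell
carries an arbitrary sum of squares `v`, with control of the sums at all intermediate times. -/
theorem PartitionSeq.exists_zigzag {T : ℝ} (𝕋 : PartitionSeq T) {N : ℕ} {a b : ℝ}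
    (ha : a ∈ 𝕋.part N) (haT : a < T) (hb : succOf T (𝕋.part N) a = b) {g : ℝ → ℝ}
    (hg : IsStepOn T (𝕋.part N) g) {v ε : ℝ} (hv : 0 < v) (hε : 0 < ε) :
    ∃ N' ≥ N, ∃ g' : ℝ → ℝ, (∀ x, x ≤ a ∨ b ≤ x → g' x = g x) ∧ IsStepOn T (𝕋.part N') g' ∧
      (∀ x, a ≤ x → x < b → |g' x - g a| ≤ |g b - g a| + ε) ∧
      (∀ s ∈ 𝕋.part N', a ≤ s → s < b → |g' (succOf T (𝕋.part N') s) - g' s| ≤ ε) ∧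
      sqSum T (𝕋.part N') g' a b = v ∧
      ∀ m ≥ N, sqSum T (𝕋.part m) g' a b ≤ 2 * (g b - g a) ^ 2 + 2 * v := by
  have hP := 𝕋.isPartition
  have hab : a < b := hb ▸ (hP N).lt_succOf haT
  have hbN : b ∈ 𝕋.part N := hb ▸ (hP N).succOf_mem a
  set Δ := g b - g a with hΔ
  obtain ⟨l, hl⟩ := exists_nat_gt (max (Δ ^ 2 / v) (max (2 * |Δ| / ε) (4 * v / ε ^ 2)))
  obtain ⟨hl1, hl2⟩ := max_lt_iff.1 hl
  obtain ⟨hl2, hl3⟩ := max_lt_iff.1 hl2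
  rw [div_lt_iff₀ hv] at hl1
  rw [div_lt_iff₀ hε] at hl2
  rw [div_lt_iff₀ (by positivity)] at hl3
  have hl0 : (0 : ℝ) < l := by
    by_contra! h
    have : 0 ≤ Δ ^ 2 := sq_nonneg _
    nlinarith
  obtain ⟨L, hL⟩ : ∃ L : ℕ, L = 2 * l := ⟨_, rfl⟩
  have hlL : (l : ℝ) ≤ L := by
    rw [hL]
    push_cast
    linarith
  have hL0 : (0 : ℝ) < L := hl0.trans_le hlL
  set d := Δ / L with hd
  have hdL : d * L = Δ := div_mul_cancel₀ _ hL0.ne'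
  have hvar : 0 ≤ v / L - d ^ 2 := by
    rw [hd, div_pow, sub_nonneg, div_le_div_iff₀ (by positivity) hL0]
    have : Δ ^ 2 ≤ v * L := by nlinarith
    nlinarith
  set σ := √(v / L - d ^ 2) with hσ
  have hσ0 : 0 ≤ σ := Real.sqrt_nonneg _
  have hσ2 : σ ^ 2 = v / L - d ^ 2 := Real.sq_sqrt hvar
  have hLv : (L : ℝ) * (d ^ 2 + σ ^ 2) = v := by
    rw [hσ2]
    field_simp
    ring
  have hdε : |d| ≤ ε / 2 := by
    rw [hd, abs_div, Nat.abs_cast, div_le_iff₀ hL0]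
    nlinarith
  have hσε : σ ≤ ε / 2 := by
    refine Real.sqrt_le_iff.2 ⟨by positivity, ?_⟩
    have : v / L ≤ (ε / 2) ^ 2 := by
      rw [div_le_iff₀ hL0]
      nlinarith [sq_nonneg ε]
    nlinarith [sq_nonneg d]
  obtain ⟨k, Y, hYk, hYab, hYc⟩ := 𝕋.exists_subset_Ioo_card L ((hP N).nonneg ha) hab
    ((hP N).le_top hbN)
  have hNN : N ≤ max N k := le_max_left _ _
  have hYN : Y ⊆ 𝕋.part (max N k) := hYk.trans (𝕋.part_mono (le_max_right N k))
  set r : ℝ → ℕ := fun x => (Y.filter (fun y => y ≤ x)).card with hr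
  have hrmono : ∀ x y, x ≤ y → r x ≤ r y := fun x y hxy =>
    Finset.card_le_card (Finset.monotone_filter_right _ fun z _ hz => le_trans hz hxy)
  have hrL : ∀ x, r x ≤ L := fun x => hYc ▸ Finset.card_filter_le _ _
  have hra : r a = 0 := by
    rw [hr]
    simp only [Finset.card_eq_zero, Finset.filter_eq_empty_iff]
    exact fun y hy => not_le.2 (hYab y hy).1
  have hrb : r b = L := by
    rw [← hYc]
    simp only [hr]
    rw [Finset.filter_true_of_mem]
    exact fun y hy => (hYab y hy).2.le
  have hrstep : ∀ s x, s ≤ x → x < succOf T (𝕋.part (max N k)) s → r x = r s := by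
    intro s x hsx hx
    simp only [hr]
    congr 1
    refine Finset.filter_congr fun y hy => ⟨fun hyx => ?_, fun hys => hys.trans hsx⟩
    by_contra! hsy
    exact absurd (succOf_le (hYN hy) hsy) (not_le.2 (hyx.trans_lt hx))
  have hrsucc : ∀ s, r (succOf T (𝕋.part (max N k)) s) ≤ r s + 1 := by
    intro s
    refine (Finset.card_le_card (t := insert (succOf T (𝕋.part (max N k)) s)
      (Y.filter (fun y => y ≤ s))) fun y hy => ?_).trans (Finset.card_insert_le _ _)
    obtain ⟨hy, hys⟩ := Finset.mem_filter.1 hy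
    rcases le_or_gt y s with h | h
    · exact Finset.mem_insert_of_mem (Finset.mem_filter.2 ⟨hy, h⟩)
    · rw [hys.antisymm (succOf_le (hYN hy) h)]
      exact Finset.mem_insert_self _ _
  set g' : ℝ → ℝ := fun x => if a ≤ x ∧ x < b then g a + zigzag d σ (r x) else g x with hg'
  have hin : ∀ x, a ≤ x → x ≤ b → g' x = g a + zigzag d σ (r x) := by
    intro x hax hxb
    rcases hxb.lt_or_eq with h | rfl
    · exact if_pos ⟨hax, h⟩
    · simp only [hg']
      rw [if_neg (fun h => lt_irrefl _ h.2), hrb, hL, zigzag_two_mul, ← hL, hdL]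
      ring
  have hout : ∀ x, x ≤ a ∨ b ≤ x → g' x = g x := by
    rintro x (h | h)
    · rcases h.lt_or_eq with h | rfl
      · exact if_neg fun h' => absurd h (not_lt.2 h'.1)
      · rw [hin x le_rfl hab.le, hra, zigzag_zero, add_zero]
    · exact if_neg fun h' => absurd h (not_le.2 h'.2)
  have hincr : ∀ m ≥ N, ∀ s ∈ 𝕋.part m, a ≤ s → s < b →
      g' (succOf T (𝕋.part m) s) - g' s =
        zigzag d σ (r (succOf T (𝕋.part m) s)) - zigzag d σ (r s) := by
    intro m hm s hs has hsb
    rw [hin s has hsb.le, hin _ (has.trans ((hP m).le_succOf hs))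
      (succOf_le (𝕋.part_mono hm hbN) hsb)]
    ring
  have hcases : ∀ s ∈ 𝕋.part (max N k), r (succOf T (𝕋.part (max N k)) s) = r s ∨
      r (succOf T (𝕋.part (max N k)) s) = r s + 1 := by
    intro s hs
    rcases (hrsucc s).lt_or_eq with h | h
    · exact Or.inl ((Nat.lt_succ_iff.1 h).antisymm (hrmono _ _ ((hP _).le_succOf hs)))
    · exact Or.inr h
  refine ⟨max N k, hNN, g', hout, ?_, ?_, ?_, ?_, ?_⟩
  · intro s hs x hsx hxs
    have hg2 := hg.mono (hP N) (hP _) (𝕋.part_mono hNN)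
    rcases lt_or_ge s a with hsa | has
    · have := succOf_le (T := T) (𝕋.part_mono hNN ha) hsa
      rw [hout s (Or.inl hsa.le), hout x (Or.inl (hxs.le.trans this))]
      exact hg2 s hs x hsx hxs
    rcases lt_or_ge s b with hsb | hbs
    · have := succOf_le (T := T) (𝕋.part_mono hNN hbN) hsb
      rw [hin s has hsb.le, hin x (has.trans hsx) (hxs.le.trans this), hrstep s x hsx hxs]
    · rw [hout s (Or.inr hbs), hout x (Or.inr (hbs.trans hsx))]
      exact hg2 s hs x hsx hxs
  · intro x hax hxb
    rw [hin x hax hxb.le, add_sub_cancel_left]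
    refine (abs_zigzag_le hσ0 (hrL x)).trans ?_
    rw [hdL]
    linarith
  · intro s hs has hsb
    rw [hincr _ hNN s hs has hsb]
    rcases hcases s hs with h | h
    · rw [h, sub_self, abs_zero]
      exact hε.le
    · rw [h]
      exact (abs_zigzag_succ_sub_le hσ0 _).trans (by linarith)
  · rw [sqSum_eq_of_eq (hP _) (fun x => ∑ i ∈ Finset.range (r x),
      (zigzag d σ (i + 1) - zigzag d σ i) ^ 2) (𝕋.part_mono hNN ha) (𝕋.part_mono hNN hbN) hab.le]
    · simp only [hra, hrb, Finset.sum_range_zero, sub_zero]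
      rw [hL, sum_sq_zigzag, ← hL, hLv]
    · intro s hs has hsb
      rw [hincr _ hNN s hs has hsb]
      rcases hcases s hs with h | h
      · rw [h]
        ring
      · rw [h, Finset.sum_range_succ]
        ring
  · intro m hm
    have := sqSum_le_of_le (f := g') (hP m) (fun x => 2 * (d ^ 2 * L + σ ^ 2) * r x)
      (𝕋.part_mono hm ha) (𝕋.part_mono hm hbN) hab.le fun s hs has hsb => by
        rw [hincr m hm s hs has hsb]
        have := sq_zigzag_sub_le (d := d) (σ := σ) (hrmono _ _ ((hP m).le_succOf hs))
          (hrL (succOf T (𝕋.part m) s))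
        linarith
    refine this.trans ?_
    simp only [hra, hrb]
    have hΔ2 : Δ ^ 2 = d ^ 2 * L * L := by
      rw [← hdL]
      ring
    have hd0 : 0 ≤ L * d ^ 2 := by positivity
    rw [hΔ2, ← hLv]
    push_cast
    linarith

/-- `f` is a step function on the `n`-th partition whose sums of squared increments at the
partition points are close to `2 * x`, everything at scale `ε`. -/
structure IsApprox {T : ℝ} (𝕋 : PartitionSeq T) (n : ℕ) (f : ℝ → ℝ) (ε : ℝ) : Prop where
  step : IsStepOn T (𝕋.part n) f
  mesh_le : ∀ s ∈ 𝕋.part n, succOf T (𝕋.part n) s - s ≤ ε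
  incr_le : ∀ s ∈ 𝕋.part n, |f (succOf T (𝕋.part n) s) - f s| ≤ ε
  sqSum_le : ∀ x ∈ 𝕋.part n, |sqSum T (𝕋.part n) f 0 x - 2 * x| ≤ 4 * ε

theorem sqSum_const {T : ℝ} {P : Finset ℝ} {a b c : ℝ} : sqSum T P (fun _ => c) a b = 0 := by
  simp [sqSum]

namespace IsApprox

variable {T : ℝ} {𝕋 : PartitionSeq T} {n : ℕ} {f : ℝ → ℝ} {ε : ℝ}

/-- Processing the cells of the partition one after the other, from left to right up to `c`, so
that each processed cell gets the right sum of squares. -/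
theorem exists_sweep (h : IsApprox 𝕋 n f ε) (hε : 0 < ε) {ε' : ℝ} (hε' : 0 < ε') {M : ℕ}
    (hM : n ≤ M) {c : ℝ} (hc : c ∈ 𝕋.part n) :
    ∃ N ≥ M, ∃ g : ℝ → ℝ, IsStepOn T (𝕋.part N) g ∧ (∀ x ∈ 𝕋.part n, g x = f x) ∧
      (∀ x, c ≤ x → g x = f x) ∧
      (∀ s ∈ 𝕋.part N, s < c → |g (succOf T (𝕋.part N) s) - g s| ≤ ε') ∧
      (∀ x, |g x - f x| ≤ ε + ε') ∧
      (∀ x ∈ 𝕋.part n, x ≤ c → sqSum T (𝕋.part N) g 0 x = 2 * x) ∧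
      ∀ m, n ≤ m → m ≤ N → ∀ x ∈ 𝕋.part n,
        |sqSum T (𝕋.part m) g 0 x - 2 * x| ≤ 12 * ε + 2 * ε ^ 2 := by
  have hP := 𝕋.isPartition
  have hmono : ∀ {i j x}, i ≤ j → x ∈ 𝕋.part i → x ∈ 𝕋.part j := fun hij hx =>
    𝕋.part_mono hij hx
  have h0 : ∀ i, (0 : ℝ) ∈ 𝕋.part i := 𝕋.zero_mem
  refine (hP n).induction_from (h0 n) (p := fun c => ∃ N ≥ M, ∃ g : ℝ → ℝ,
      IsStepOn T (𝕋.part N) g ∧ (∀ x ∈ 𝕋.part n, g x = f x) ∧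
      (∀ x, c ≤ x → g x = f x) ∧
      (∀ s ∈ 𝕋.part N, s < c → |g (succOf T (𝕋.part N) s) - g s| ≤ ε') ∧
      (∀ x, |g x - f x| ≤ ε + ε') ∧
      (∀ x ∈ 𝕋.part n, x ≤ c → sqSum T (𝕋.part N) g 0 x = 2 * x) ∧
      ∀ m, n ≤ m → m ≤ N → ∀ x ∈ 𝕋.part n,
        |sqSum T (𝕋.part m) g 0 x - 2 * x| ≤ 12 * ε + 2 * ε ^ 2) ?_ ?_ c hc ((hP n).nonneg hc)
  · refine ⟨M, le_rfl, f, h.step.mono (hP n) (hP M) (𝕋.part_mono hM), fun _ _ => rfl,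
      fun _ _ => rfl, fun s hs hs0 => absurd ((hP M).nonneg hs) (not_le.2 hs0), fun x => ?_,
      fun x hx hx0 => ?_, fun m hnm _ x hx => ?_⟩
    · rw [sub_self, abs_zero]
      positivity
    · rw [hx0.antisymm ((hP n).nonneg hx), sqSum_self, mul_zero]
    · rw [h.step.sqSum_eq (hP n) (hP m) (𝕋.part_mono hnm) (h0 n) hx ((hP n).nonneg hx)]
      refine (h.sqSum_le x hx).trans ?_
      nlinarith
  rintro c hc hc0 hcT ⟨N, hMN, g, hgstep, hgP, hgc, hgincr, hgf, hg2, hgm⟩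
  have hnN : n ≤ N := hM.trans hMN
  set c' := succOf T (𝕋.part n) c with hc'
  have hcc' : c < c' := (hP n).lt_succOf hcT
  have hc'n : c' ∈ 𝕋.part n := (hP n).succOf_mem c
  have hsep : ∀ x ∈ 𝕋.part n, x ≤ c ∨ c' ≤ x := fun x hx =>
    (le_or_gt x c).imp_right (succOf_le hx)
  obtain ⟨a, ha, hac', haN⟩ := (hP N).exists_pred (hmono hnN hc'n) (hc0.trans_lt hcc')
  have hca : c ≤ a := by
    by_contra! hlt
    exact absurd (succOf_le (T := T) (hmono hnN hc) hlt) (not_le.2 (haN ▸ hcc'))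
  have hflat : ∀ x, c ≤ x → x < c' → f x = f c := fun x => h.step c hc x
  have hga : g a = f c := by rw [hgc a hca, hflat a hca hac']
  have hgc' : g c' = f c' := hgP c' hc'n
  have hv : 0 < 2 * (c' - c) := by linarith
  obtain ⟨N', hNN', g', hout, hstep', hin, hincr', hsq, hsqm⟩ :=
    𝕋.exists_zigzag ha (hac'.trans_le ((hP n).le_top hc'n)) haN hgstep hv hε'
  rw [hga, hgc'] at hin hsqm
  have hΔ : |f c' - f c| ≤ ε := h.incr_le c hc
  have hμ : c' - c ≤ ε := h.mesh_le c hc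
  have hleft : ∀ m ≥ N, ∀ x ∈ 𝕋.part n, x ≤ c → sqSum T (𝕋.part m) g' 0 x = 2 * x := by
    intro m hm x hx hxc
    rw [sqSum_congr (g := g) (hP m) (hmono (hnN.trans hm) hx)
      fun y _ _ hy => hout y (Or.inl (hy.trans (hxc.trans hca))),
      hgstep.sqSum_eq (hP N) (hP m) (𝕋.part_mono hm) (h0 N) (hmono hnN hx) ((hP n).nonneg hx),
      hg2 x hx hxc]
  have hmid : ∀ m ≥ N, sqSum T (𝕋.part m) g' 0 c' = 2 * c + sqSum T (𝕋.part m) g' a c' := by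
    intro m hm
    rw [← sqSum_add hc0 hcc'.le, ← sqSum_add hca hac'.le, hleft m hm c hc le_rfl,
      sqSum_congr (b := a) (g := fun _ => f c) (hP m) (hmono hm ha), sqSum_const, zero_add]
    intro x _ hcx hxa
    rw [hout x (Or.inl hxa), hgc x hcx, hflat x hcx (hxa.trans_lt hac')]
  refine ⟨N', hMN.trans hNN', g', hstep', ?_, ?_, ?_, ?_, ?_, ?_⟩
  · intro x hx
    rw [hout x ((hsep x hx).imp_left fun hxc => hxc.trans hca), hgP x hx]
  · intro x hx
    rw [hout x (Or.inr hx), hgc x (hcc'.le.trans hx)]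
  · intro s hs hsc'
    rcases lt_or_ge s a with hsa | has
    · have hle := succOf_le (T := T) (hmono hNN' ha) hsa
      rw [hout s (Or.inl hsa.le), hout _ (Or.inl hle)]
      rcases lt_or_ge s c with hsc | hcs
      · exact hgstep.abs_sub_le (hP N) (hP N') (𝕋.part_mono hNN') hε'.le hs (hsc.trans hcT)
          fun p hp hps => hgincr p hp (hps.trans_lt hsc)
      · have hcs' := hcs.trans ((hP N').le_succOf hs)
        rw [hgc s hcs, hgc _ hcs', hflat s hcs hsc', hflat _ hcs' (hle.trans_lt hac'), sub_self,
          abs_zero]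
        exact hε'.le
    · exact hincr' s hs has hsc'
  · intro x
    by_cases hx : a ≤ x ∧ x < c'
    · rw [hflat x (hca.trans hx.1) hx.2]
      exact (hin x hx.1 hx.2).trans (by linarith)
    · rw [hout x]
      · exact hgf x
      · by_contra! hcon
        exact hx ⟨hcon.1.le, hcon.2⟩
  · intro x hx hxc'
    rcases hsep x hx with hxc | hcx
    · exact hleft N' hNN' x hx hxc
    · rw [hxc'.antisymm hcx, hmid N' hNN', hsq]
      ring
  · intro m hnm hmN' x hx
    rcases le_total m N with hmN | hNm
    · rw [sqSum_congr (g := g) (hP m) (hmono hnm hx)]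
      · exact hgm m hnm hmN x hx
      · intro y hy _ _
        refine hout y ?_
        rcases le_or_gt y a with hya | hay
        · exact Or.inl hya
        · exact Or.inr (haN ▸ succOf_le (hmono hmN hy) hay)
    rcases hsep x hx with hxc | hcx
    · rw [hleft m hNm x hx hxc, sub_self, abs_zero]
      positivity
    · have hright : sqSum T (𝕋.part m) g' c' x = sqSum T (𝕋.part n) f c' x := by
        rw [← h.step.sqSum_eq (hP n) (hP m) (𝕋.part_mono hnm) hc'n hx hcx]
        refine sqSum_congr (hP m) (hmono hnm hx) fun y _ hy _ => ?_
        rw [hout y (Or.inr hy), hgc y (hcc'.le.trans hy)]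
      have hsplit := sqSum_add (T := T) (P := 𝕋.part n) (f := f) (hc0.trans hcc'.le) hcx
      have hx1 := abs_le.1 (h.sqSum_le x hx)
      have hx2 := abs_le.1 (h.sqSum_le c' hc'n)
      have hact := hsqm m hNm
      have hact0 : 0 ≤ sqSum T (𝕋.part m) g' a c' := sqSum_nonneg
      have hΔ2 : (f c' - f c) ^ 2 ≤ ε ^ 2 := sq_le_sq' (by linarith [(abs_le.1 hΔ).1])
        (abs_le.1 hΔ).2
      rw [← sqSum_add (hc0.trans hcc'.le) hcx, hmid m hNm, hright, abs_le]
      constructor <;> nlinarith [hx1.1, hx1.2, hx2.1, hx2.2]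

theorem exists_refinement (h : IsApprox 𝕋 n f ε) (hε : 0 < ε) :
    ∃ N > n, ∃ g : ℝ → ℝ, IsApprox 𝕋 N g (ε / 2) ∧ (∀ x ∈ 𝕋.part n, g x = f x) ∧
      (∀ x, |g x - f x| ≤ 2 * ε) ∧
      ∀ m, n ≤ m → m ≤ N → ∀ x ∈ 𝕋.part n,
        |sqSum T (𝕋.part m) g 0 x - 2 * x| ≤ 12 * ε + 2 * ε ^ 2 := by
  have hP := 𝕋.isPartition
  obtain ⟨K, hK⟩ := 𝕋.mesh_to_zero (ε / 2) (half_pos hε)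
  obtain ⟨N, hN, g, hstep, hgP, -, hincr, hgf, hsq, hm⟩ :=
    h.exists_sweep hε (half_pos hε) ((Nat.le_succ n).trans (le_max_left (n + 1) K)) (𝕋.top_mem n)
  have hnN : n < N := (le_max_left (n + 1) K).trans hN
  refine ⟨N, hnN, g, ⟨hstep, fun s hs => (hK N ((le_max_right (n + 1) K).trans hN) s hs).le,
    fun s hs => ?_, fun x hx => ?_⟩, hgP, fun x => (hgf x).trans (by linarith), hm⟩
  · rcases ((hP N).le_top hs).lt_or_eq with hsT | rfl
    · exact hincr s hs hsT
    · rw [(hP N).succOf_top, sub_self, abs_zero]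
      positivity
  · rcases ((hP N).le_top hx).lt_or_eq with hxT | rfl
    · obtain ⟨p, hp, hpx, -, hle⟩ := exists_coarse_cell (hP n) (hP N) (𝕋.part_mono hnN.le) hx hxT
      have hp0 := (hP n).nonneg hp
      have hxp : x ≤ succOf T (𝕋.part n) p := ((hP N).le_succOf hx).trans hle
      have h1 := sqSum_add (T := T) (P := 𝕋.part N) (f := g) hp0 hpx
      have h2 := sqSum_add (T := T) (P := 𝕋.part N) (f := g) (hp0.trans hpx) hxp
      have h3 : 0 ≤ sqSum T (𝕋.part N) g p x := sqSum_nonneg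
      have h4 : 0 ≤ sqSum T (𝕋.part N) g x (succOf T (𝕋.part n) p) := sqSum_nonneg
      rw [hsq p hp ((hP n).le_top hp)] at h1
      rw [hsq _ ((hP n).succOf_mem p) ((hP n).le_top ((hP n).succOf_mem p))] at h2
      have := h.mesh_le p hp
      rw [abs_le]
      constructor <;> linarith
    · rw [hsq _ (𝕋.top_mem n) le_rfl, sub_self, abs_zero]
      positivity

end IsApprox

/-- The values of a step function with increments at most `ε` vary locally by at most `ε`. -/
theorem IsApprox.eventually_abs_sub_le {T : ℝ} {𝕋 : PartitionSeq T} {n : ℕ} {f : ℝ → ℝ} {ε : ℝ}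
    (h : IsApprox 𝕋 n f ε) (hε : 0 ≤ ε) {x : ℝ} (hx : x ∈ Set.Icc 0 T) :
    ∀ᶠ y in 𝓝[Set.Icc 0 T] x, |f y - f x| ≤ ε := by
  have hP := 𝕋.isPartition n
  have hright : ∀ᶠ y in 𝓝[Set.Icc 0 T] x, x ≤ y → |f y - f x| ≤ ε := by
    rcases hx.2.lt_or_eq with hxT | rfl
    · obtain ⟨p, hp, hpx, hxp⟩ := hP.exists_floor hx.1 hxT
      filter_upwards [mem_nhdsWithin_of_mem_nhds (Iio_mem_nhds hxp)] with y hy hxy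
      rw [h.step p hp y (hpx.trans hxy) hy, h.step p hp x hpx hxp, sub_self, abs_zero]
      exact hε
    · filter_upwards [self_mem_nhdsWithin] with y hy hxy
      rw [hy.2.antisymm hxy, sub_self, abs_zero]
      exact hε
  have hleft : ∀ᶠ y in 𝓝[Set.Icc 0 T] x, y ≤ x → |f y - f x| ≤ ε := by
    rcases hx.1.eq_or_lt with rfl | hx0
    · filter_upwards [self_mem_nhdsWithin] with y hy hyx
      rw [hyx.antisymm hy.1, sub_self, abs_zero]
      exact hε
    obtain ⟨p, hp, hpx, hxp⟩ : ∃ p ∈ 𝕋.part n, p < x ∧ x ≤ succOf T (𝕋.part n) p := by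
      by_cases hxm : x ∈ 𝕋.part n
      · obtain ⟨p, hp, hpx, hxp⟩ := hP.exists_pred hxm hx0
        exact ⟨p, hp, hpx, hxp.ge⟩
      · obtain ⟨p, hp, hpx, hxp⟩ := hP.exists_floor hx.1
          (lt_of_le_of_ne hx.2 fun hxT => hxm (hxT ▸ 𝕋.top_mem n))
        exact ⟨p, hp, lt_of_le_of_ne hpx fun hpx => hxm (hpx ▸ hp), hxp.le⟩
    filter_upwards [mem_nhdsWithin_of_mem_nhds (Ioi_mem_nhds hpx)] with y hpy hyx
    rcases hyx.eq_or_lt with rfl | hyx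
    · rw [sub_self, abs_zero]
      exact hε
    rw [h.step p hp y (le_of_lt hpy) (hyx.trans_le hxp)]
    rcases hxp.lt_or_eq with hxp | hxp
    · rw [h.step p hp x hpx.le hxp, sub_self, abs_zero]
      exact hε
    · rw [abs_sub_comm, hxp]
      exact h.incr_le p hp
  filter_upwards [hright, hleft] with y h1 h2
  exact (le_total x y).elim h1 h2

/-- The quadratic variation sum up to time `t` lies between the sums over the points of a coarser
partition surrounding `t`. -/
theorem abs_sum_sub_le {T : ℝ} {P Q : Finset ℝ} (hP : IsPartition T P) (hQ : IsPartition T Q)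
    {f : ℝ → ℝ} {ε e : ℝ} (hε : 0 ≤ ε) (hmesh : ∀ s ∈ P, succOf T P s - s ≤ ε)
    (h : ∀ x ∈ P, |sqSum T Q f 0 x - 2 * x| ≤ e) {t : ℝ} (ht : t ∈ Set.Icc 0 T) :
    |∑ s ∈ Q.filter (fun s => s ≤ t), (f (succOf T Q s) - f s) ^ 2 - 2 * t| ≤ e + 2 * ε := by
  rcases ht.2.lt_or_eq with htT | rfl
  · obtain ⟨p, hp, hpt, htp⟩ := hP.exists_floor ht.1 htT
    have h1 : sqSum T Q f 0 p ≤
        ∑ s ∈ Q.filter (fun s => s ≤ t), (f (succOf T Q s) - f s) ^ 2 :=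
      Finset.sum_le_sum_of_subset_of_nonneg
        (Finset.monotone_filter_right _ fun s _ hs => hs.2.le.trans hpt) fun _ _ _ => sq_nonneg _
    have h2 : ∑ s ∈ Q.filter (fun s => s ≤ t), (f (succOf T Q s) - f s) ^ 2 ≤
        sqSum T Q f 0 (succOf T P p) := by
      refine Finset.sum_le_sum_of_subset_of_nonneg (fun s hs => ?_) fun _ _ _ => sq_nonneg _
      obtain ⟨hs, hst⟩ := Finset.mem_filter.1 hs
      exact Finset.mem_filter.2 ⟨hs, hQ.nonneg hs, hst.trans_lt htp⟩
    have h3 := abs_le.1 (h p hp)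
    have h4 := abs_le.1 (h _ (hP.succOf_mem p))
    have := hmesh p hp
    rw [abs_le]
    constructor <;> linarith [h3.1, h4.2]
  · have : ∑ s ∈ Q.filter (fun s => s ≤ t), (f (succOf t Q s) - f s) ^ 2 = sqSum t Q f 0 t := by
      symm
      refine Finset.sum_subset (Finset.monotone_filter_right _ fun s _ hs => hs.2.le)
        fun s hs hs' => ?_
      obtain ⟨hs, hst⟩ := Finset.mem_filter.1 hs
      have : s = t := by
        refine hst.antisymm ?_
        by_contra! hlt
        exact hs' (Finset.mem_filter.2 ⟨hs, hQ.nonneg hs, hlt⟩)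
      rw [this, hQ.succOf_top]
      ring
    rw [this]
    linarith [h t hP.top_mem]

/-- There is a continuous function with quadratic variation `2 * t` along the partitions. -/
theorem PartitionSeq.exists_quadraticVariation {T : ℝ} (𝕋 : PartitionSeq T) (hT : 0 < T) :
    ∃ X : ℝ → ℝ, ContinuousOn X (Set.Icc 0 T) ∧ ∀ t ∈ Set.Icc (0 : ℝ) T,
      Tendsto (fun n => ∑ s ∈ (𝕋.part n).filter (fun s => s ≤ t),
        (X (succOf T (𝕋.part n) s) - X s) ^ 2) atTop (𝓝 (2 * t)) := by
  have hP := 𝕋.isPartition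
  have hε : ∀ k : ℕ, 0 < T / 2 ^ k := fun k => by positivity
  have hnext : ∀ (k : ℕ) (p : {p : ℕ × (ℝ → ℝ) // IsApprox 𝕋 p.1 p.2 (T / 2 ^ k)}),
      ∃ q : {q : ℕ × (ℝ → ℝ) // IsApprox 𝕋 q.1 q.2 (T / 2 ^ (k + 1))}, p.1.1 < q.1.1 ∧
        (∀ x ∈ 𝕋.part p.1.1, q.1.2 x = p.1.2 x) ∧
        (∀ x, |q.1.2 x - p.1.2 x| ≤ 2 * (T / 2 ^ k)) ∧
        ∀ m, p.1.1 ≤ m → m ≤ q.1.1 → ∀ x ∈ 𝕋.part p.1.1,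
          |sqSum T (𝕋.part m) q.1.2 0 x - 2 * x| ≤ 12 * (T / 2 ^ k) + 2 * (T / 2 ^ k) ^ 2 := by
    rintro k ⟨⟨n, f⟩, hf⟩
    obtain ⟨N, hN, g, hg, h⟩ := hf.exists_refinement (hε k)
    refine ⟨⟨⟨N, g⟩, ?_⟩, hN, h⟩
    rwa [pow_succ, ← div_div]
  have hinit : IsApprox 𝕋 0 (fun _ => 0) (T / 2 ^ 0) := by
    refine ⟨fun _ _ _ _ _ => rfl, fun s hs => ?_, fun s _ => ?_, fun x hx => ?_⟩
    · have := (hP 0).nonneg hs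
      have := (hP 0).le_top ((hP 0).succOf_mem s)
      rw [pow_zero, div_one]
      linarith
    · rw [sub_self, abs_zero]
      exact (hε 0).le
    · have := (hP 0).nonneg hx
      have := (hP 0).le_top hx
      rw [sqSum_const, pow_zero, div_one, abs_le]
      constructor <;> linarith
  choose next hlt hext hdist hvar using hnext
  let F : (k : ℕ) → {p : ℕ × (ℝ → ℝ) // IsApprox 𝕋 p.1 p.2 (T / 2 ^ k)} := fun k =>
    Nat.rec ⟨(0, fun _ => 0), hinit⟩ next k
  let N : ℕ → ℕ := fun k => (F k).1.1
  let f : ℕ → ℝ → ℝ := fun k => (F k).1.2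
  have hf : ∀ k, IsApprox 𝕋 (N k) (f k) (T / 2 ^ k) := fun k => (F k).2
  have hN : StrictMono N := strictMono_nat_of_lt_succ fun k => hlt k (F k)
  have hfext : ∀ k, ∀ x ∈ 𝕋.part (N k), f (k + 1) x = f k x := fun k => hext k (F k)
  have hfdist : ∀ k x, |f (k + 1) x - f k x| ≤ 2 * (T / 2 ^ k) := fun k => hdist k (F k)
  have hfvar : ∀ k m, N k ≤ m → m ≤ N (k + 1) → ∀ x ∈ 𝕋.part (N k),
      |sqSum T (𝕋.part m) (f (k + 1)) 0 x - 2 * x| ≤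
        12 * (T / 2 ^ k) + 2 * (T / 2 ^ k) ^ 2 := fun k => hvar k (F k)
  have hgeo : ∀ x k, dist (f k x) (f (k + 1) x) ≤ 4 * T / 2 / 2 ^ k := by
    intro x k
    rw [dist_comm, Real.dist_eq]
    refine (hfdist k x).trans_eq ?_
    ring
  choose X hX using fun x =>
    cauchySeq_tendsto_of_complete (cauchySeq_of_le_geometric_two (hgeo x))
  have hXdist : ∀ x k, |f k x - X x| ≤ 4 * T / 2 ^ k := fun x k =>
    dist_le_of_le_geometric_two_of_tendsto (hgeo x) (hX x) k
  have hXeq : ∀ k, ∀ x ∈ 𝕋.part (N k), X x = f k x := by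
    intro k x hx
    refine tendsto_nhds_unique (hX x) (tendsto_const_nhds.congr' ?_)
    filter_upwards [eventually_ge_atTop k] with j hj
    induction j, hj using Nat.le_induction with
    | base => rfl
    | succ j hj ih => rw [hfext j x (𝕋.part_mono (hN.monotone hj) hx), ih]
  have hsmall : ∀ C η : ℝ, 0 < η → ∃ k : ℕ, C / 2 ^ k < η := by
    intro C η hη
    have : Tendsto (fun k : ℕ => C / 2 ^ k) atTop (𝓝 0) :=
      tendsto_const_nhds.div_atTop (tendsto_pow_atTop_atTop_of_one_lt one_lt_two)
    exact (this.eventually_lt_const hη).exists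
  refine ⟨X, fun x hx => ?_, fun t ht => ?_⟩
  · rw [ContinuousWithinAt, Metric.tendsto_nhds]
    intro η hη
    obtain ⟨k, hk⟩ := hsmall (9 * T) η hη
    filter_upwards [(hf k).eventually_abs_sub_le (hε k).le hx] with y hy
    have h1 := abs_le.1 (hXdist x k)
    have h2 := abs_le.1 (hXdist y k)
    have h3 := abs_le.1 hy
    have e1 : 9 * T / 2 ^ k = 9 * (T / 2 ^ k) := by ring
    have e2 : 4 * T / 2 ^ k = 4 * (T / 2 ^ k) := by ring
    rw [e2] at h1 h2
    rw [e1] at hk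
    rw [Real.dist_eq, abs_lt]
    constructor <;> linarith [h1.1, h1.2, h2.1, h2.2, h3.1, h3.2]
  · rw [Metric.tendsto_atTop]
    intro η hη
    obtain ⟨k₀, hk₀⟩ := hsmall ((14 + 2 * T) * T) η hη
    have hbetween : ∀ m ≥ N k₀, ∃ k ≥ k₀, N k ≤ m ∧ m ≤ N (k + 1) := by
      intro m hm
      induction m, hm using Nat.le_induction with
      | base => exact ⟨k₀, le_rfl, le_rfl, (hN k₀.lt_succ_self).le⟩
      | succ m _ ih =>
        obtain ⟨k, hk, h1, h2⟩ := ih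
        rcases h2.lt_or_eq with h2 | h2
        · exact ⟨k, hk, h1.trans m.le_succ, h2⟩
        · refine ⟨k + 1, hk.trans k.le_succ, h2 ▸ m.le_succ, ?_⟩
          rw [h2]
          exact hN (k + 1).lt_succ_self
    refine ⟨N k₀, fun m hm => ?_⟩
    obtain ⟨k, hk, hkm, hmk⟩ := hbetween m hm
    have hle : T / 2 ^ k ≤ T / 2 ^ k₀ :=
      div_le_div_of_nonneg_left hT.le (by positivity) (pow_le_pow_right₀ one_le_two hk)
    have hleT : T / 2 ^ k ≤ T := div_le_self hT.le (one_le_pow₀ one_le_two)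
    have key := abs_sum_sub_le (hP (N k)) (hP m) (f := X) (hε k).le (hf k).mesh_le
      (fun x hx => by
        rw [sqSum_congr (g := f (k + 1)) (hP m) (𝕋.part_mono hkm hx)
          fun y hy _ _ => hXeq (k + 1) y (𝕋.part_mono hmk hy)]
        exact hfvar k m hkm hmk x hx) ht
    rw [Real.dist_eq]
    refine key.trans_lt (lt_of_le_of_lt ?_ hk₀)
    have e : (14 + 2 * T) * T / 2 ^ k₀ = (14 + 2 * T) * (T / 2 ^ k₀) := by ring
    rw [e]
    have := hε k
    nlinarith

/-- Adding an affine function does not change the quadratic variation. -/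
theorem PartitionSeq.tendsto_add_affine {T : ℝ} (𝕋 : PartitionSeq T) {X : ℝ → ℝ}
    (hX : ContinuousOn X (Set.Icc 0 T)) {t v : ℝ}
    (h : Tendsto (fun n => ∑ s ∈ (𝕋.part n).filter (fun s => s ≤ t),
      (X (succOf T (𝕋.part n) s) - X s) ^ 2) atTop (𝓝 v)) (α β : ℝ) :
    Tendsto (fun n => ∑ s ∈ (𝕋.part n).filter (fun s => s ≤ t),
      ((X (succOf T (𝕋.part n) s) + (α * succOf T (𝕋.part n) s + β)) -
        (X s + (α * s + β))) ^ 2) atTop (𝓝 v) := by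
  have hP := 𝕋.isPartition
  have hT : 0 ≤ T := (hP 0).nonneg (𝕋.top_mem 0)
  set Y : ℝ → ℝ := fun x => 2 * α * X x + α ^ 2 * x with hY
  have hYc : UniformContinuousOn Y (Set.Icc 0 T) :=
    isCompact_Icc.uniformContinuousOn_of_continuous (by fun_prop)
  have hdiff : Tendsto (fun n => ∑ s ∈ (𝕋.part n).filter (fun s => s ≤ t),
      (Y (succOf T (𝕋.part n) s) - Y s) * (succOf T (𝕋.part n) s - s)) atTop (𝓝 0) := by
    rw [Metric.tendsto_atTop]
    intro η hη
    have hρ : 0 < η / (T + 1) := by positivity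
    obtain ⟨δ, hδ, hYδ⟩ := Metric.uniformContinuousOn_iff.1 hYc _ hρ
    obtain ⟨K, hK⟩ := 𝕋.mesh_to_zero δ hδ
    refine ⟨K, fun n hn => ?_⟩
    have hlen : ∀ s ∈ 𝕋.part n, 0 ≤ succOf T (𝕋.part n) s - s := fun s hs =>
      sub_nonneg.2 ((hP n).le_succOf hs)
    have hsum : ∑ s ∈ 𝕋.part n, (succOf T (𝕋.part n) s - s) = T := by
      have htel := (hP n).sum_sub_telescope (fun x => x) (𝕋.zero_mem n) (𝕋.top_mem n) hT
      simp only [sub_zero] at htel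
      refine Eq.trans (Eq.symm ?_) htel
      refine Finset.sum_subset (Finset.filter_subset _ _) fun s hs hs' => ?_
      have : s = T := by
        refine ((hP n).le_top hs).antisymm ?_
        by_contra! hlt
        exact hs' (Finset.mem_filter.2 ⟨hs, (hP n).nonneg hs, hlt⟩)
      rw [this, (hP n).succOf_top, sub_self]
    rw [Real.dist_eq, sub_zero]
    calc |∑ s ∈ (𝕋.part n).filter (fun s => s ≤ t),
          (Y (succOf T (𝕋.part n) s) - Y s) * (succOf T (𝕋.part n) s - s)|
        ≤ ∑ s ∈ (𝕋.part n).filter (fun s => s ≤ t),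
          η / (T + 1) * (succOf T (𝕋.part n) s - s) := by
          refine (Finset.abs_sum_le_sum_abs _ _).trans (Finset.sum_le_sum fun s hs => ?_)
          obtain ⟨hs, -⟩ := Finset.mem_filter.1 hs
          rw [abs_mul, abs_of_nonneg (hlen s hs)]
          refine mul_le_mul_of_nonneg_right ?_ (hlen s hs)
          refine (hYδ _ (𝕋.subset_Icc n ((hP n).succOf_mem s)) s (𝕋.subset_Icc n hs) ?_).le
          rw [Real.dist_eq, abs_of_nonneg (hlen s hs)]
          exact hK n hn s hs
      _ ≤ ∑ s ∈ 𝕋.part n, η / (T + 1) * (succOf T (𝕋.part n) s - s) :=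
          Finset.sum_le_sum_of_subset_of_nonneg (Finset.filter_subset _ _)
            fun s hs _ => mul_nonneg hρ.le (hlen s hs)
      _ = η * (T / (T + 1)) := by
          rw [← Finset.mul_sum, hsum]
          ring
      _ < η := mul_lt_of_lt_one_right hη ((div_lt_one (by positivity)).2 (lt_add_one T))
  have := h.add hdiff
  rw [add_zero] at this
  refine this.congr fun n => ?_
  rw [← Finset.sum_add_distrib]
  refine Finset.sum_congr rfl fun s _ => ?_
  simp only [hY]
  ring

/-- For `d = 1` and `a ≡ 2`, the class `𝒮_a` contains trajectories connecting any two
prescribed points at any two prescribed times. -/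
theorem stmt17 (T : ℝ) (hT : 0 < T) (𝕋 : PartitionSeq T)
    (x₀ x₁ t₀ t₁ : ℝ) (h0 : 0 ≤ t₀) (h01 : t₀ < t₁) (h1 : t₁ ≤ T) :
    ∃ S : ℝ → ℝ, ContinuousOn S (Set.Icc 0 T) ∧
      (∀ t ∈ Set.Icc (0 : ℝ) T,
        Tendsto (fun n => ∑ s ∈ (𝕋.part n).filter (fun s => s ≤ t),
          (S (succOf T (𝕋.part n) s) - S s) ^ 2) atTop (𝓝 (2 * t))) ∧
      S t₀ = x₀ ∧ S t₁ = x₁ := by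
  obtain ⟨X, hX, hqv⟩ := 𝕋.exists_quadraticVariation hT
  have hne : t₁ - t₀ ≠ 0 := (sub_pos.2 h01).ne'
  set α := (x₁ - X t₁ - (x₀ - X t₀)) / (t₁ - t₀) with hα
  have hα' : α * (t₁ - t₀) = x₁ - X t₁ - (x₀ - X t₀) := div_mul_cancel₀ _ hne
  refine ⟨fun x => X x + (α * x + (x₀ - X t₀ - α * t₀)), by fun_prop,
    fun t ht => 𝕋.tendsto_add_affine hX (hqv t ht) _ _, ?_, ?_⟩
  · ring
  · linear_combination hα'
end
end

section
/- Let d=1 and a≡2 (constant), so that ℒ=∂²/∂x². There exists a non-admissible arbitrage opportunity: there exist T>0, a function v ∈ C^{1,2}([0,T)×ℝ)∩C([0,T]×ℝ) with ∂v/∂t + ∂²v/∂x² = 0 on [0,T)×ℝ and v(T,x)=0 for all x (so that V^S(T)=0 ≥ 0 for every S∈𝒮_a), a path S∈𝒮_a, and a time T_0∈(0,T] such that v(0,S(0))=0 and v(T_0,S(T_0))>0. That is, with V^S(t):=v(t,S(t)), conditions (a) and (b) of the definition of an arbitrage opportunity hold. -/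
open Finset Filter Topology Set

noncomputable section

/-- `v` is of class `C^{1,2}(I × ℝ)` (one space dimension). -/
structure IsC12s (I : Set ℝ) (v : ℝ → ℝ → ℝ) : Prop where
  cont : ContinuousOn (fun p : ℝ × ℝ => v p.1 p.2) (I ×ˢ (Set.univ : Set ℝ))
  diff : ∀ t ∈ interior I, ∀ x : ℝ, DifferentiableAt ℝ (fun p : ℝ × ℝ => v p.1 p.2) (t, x)
  diff2 : ∀ t ∈ interior I, ∀ x : ℝ, DifferentiableAt ℝ (deriv (v t)) x
  derivs_extend : ∃ gt gx gxx : ℝ × ℝ → ℝ,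
    ContinuousOn gt (I ×ˢ (Set.univ : Set ℝ)) ∧ ContinuousOn gx (I ×ˢ (Set.univ : Set ℝ)) ∧
    ContinuousOn gxx (I ×ˢ (Set.univ : Set ℝ)) ∧
    ∀ t ∈ interior I, ∀ x : ℝ,
      gt (t, x) = deriv (fun τ => v τ x) t ∧ gx (t, x) = deriv (v t) x ∧
      gxx (t, x) = deriv (deriv (v t)) x

/-! ### A null solution of the heat equation -/

theorem exists_quartic_bound {c : ℝ} (hc : 0 ≤ c) :
    ∃ K : ℝ, ∀ s : ℝ, |s| + c * |s| ^ 3 - s ^ 4 ≤ K - s ^ 2 := by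
  set R := c + 2 with hR
  refine ⟨c * R ^ 3 + R + R ^ 2, fun s => ?_⟩
  have h4 : s ^ 4 = |s| ^ 4 := by rw [show (4 : ℕ) = 2 * 2 from rfl, pow_mul, pow_mul, sq_abs]
  have h2 : s ^ 2 = |s| ^ 2 := (sq_abs s).symm
  rw [h4, h2]
  have hr := abs_nonneg s
  generalize |s| = r at hr
  rcases le_total R r with h | h
  · have h1 : 1 ≤ r := by linarith
    have h3 : r ≤ r ^ 3 := le_self_pow₀ h1 (by norm_num)
    have h23 : r ^ 2 ≤ r ^ 3 := pow_le_pow_right₀ h1 (by norm_num)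
    have : (c + 2) * r ^ 3 ≤ r * r ^ 3 := by gcongr
    have : 0 ≤ c * R ^ 3 + R + R ^ 2 := by positivity
    nlinarith
  · have : c * r ^ 3 ≤ c * R ^ 3 := by gcongr
    have : r ^ 2 ≤ R ^ 2 := by gcongr
    have : 0 ≤ r ^ 4 := by positivity
    linarith

theorem integrable_abs_pow_mul_exp (m : ℕ) (c : ℝ) :
    MeasureTheory.Integrable
      (fun s : ℝ => |s| ^ m * (Real.exp (-s ^ 4) * Real.exp (c * |s| ^ 3))) := by
  obtain ⟨K, hK⟩ := exists_quartic_bound (abs_nonneg c)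
  have hg := (integrable_exp_neg_mul_sq (b := 1) one_pos).const_mul ((m.factorial : ℝ) * Real.exp K)
  refine hg.mono' (by fun_prop) (MeasureTheory.ae_of_all _ fun s => ?_)
  rw [Real.norm_of_nonneg (by positivity)]
  have h1 : |s| ^ m ≤ m.factorial * Real.exp |s| := by
    have := Real.pow_div_factorial_le_exp _ (abs_nonneg s) m
    rwa [div_le_iff₀' (by positivity)] at this
  calc |s| ^ m * (Real.exp (-s ^ 4) * Real.exp (c * |s| ^ 3))
      ≤ (m.factorial * Real.exp |s|) * (Real.exp (-s ^ 4) * Real.exp (|c| * |s| ^ 3)) := by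
        gcongr; exact le_abs_self c
    _ = m.factorial * Real.exp (|s| + |c| * |s| ^ 3 - s ^ 4) := by
        rw [mul_assoc, ← Real.exp_add, ← Real.exp_add]; ring_nf
    _ ≤ m.factorial * Real.exp (K - s ^ 2) := 
        mul_le_mul_of_nonneg_left (Real.exp_le_exp.2 (hK s)) (by positivity)
    _ = _ := by rw [mul_assoc, ← Real.exp_add]; ring_nf

/-- The density of the null solution. -/
def nullDensity (s : ℝ) : ℝ := |s| ^ 5 * (Real.exp (-s ^ 4) * Real.cos (√3 * s ^ 4))

theorem continuous_nullDensity : Continuous nullDensity := by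
  unfold nullDensity; fun_prop

theorem abs_nullDensity_le (s : ℝ) : |nullDensity s| ≤ |s| ^ 5 * Real.exp (-s ^ 4) := by
  unfold nullDensity
  rw [abs_mul, abs_mul, abs_of_nonneg (by positivity : 0 ≤ |s| ^ 5), Real.abs_exp]
  gcongr
  exact mul_le_of_le_one_right (Real.exp_pos _).le (Real.abs_cos_le_one _)

theorem nullDensity_neg (s : ℝ) : nullDensity (-s) = nullDensity s := by
  simp [nullDensity, Even.neg_pow (show Even 4 by decide)]

/-- The integrand of `nullWave`. -/
def nullKernel (k : ℕ) (p : ℝ × ℝ) (s : ℝ) : ℂ :=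
  (nullDensity s * s ^ (3 * k) : ℝ) *
    Complex.exp ((1 + Complex.I) * s ^ 3 * p.2 + 2 * Complex.I * s ^ 6 * p.1)

/-- Complex-valued solutions of the heat equation (in the variables `p = (τ, x)`). -/
def nullWave (k : ℕ) (p : ℝ × ℝ) : ℂ := ∫ s, nullKernel k p s

theorem continuous_nullKernel (k : ℕ) (p : ℝ × ℝ) : Continuous (nullKernel k p) := by
  have := continuous_nullDensity
  unfold nullKernel; fun_prop

theorem norm_nullKernel_le (k : ℕ) (p : ℝ × ℝ) {c : ℝ} (hc : |p.2| ≤ c) (s : ℝ) :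
    ‖nullKernel k p s‖ ≤ |s| ^ (5 + 3 * k) * (Real.exp (-s ^ 4) * Real.exp (c * |s| ^ 3)) := by
  unfold nullKernel
  rw [norm_mul, Complex.norm_real, Complex.norm_exp, Real.norm_eq_abs, abs_mul, abs_pow]
  have hre : ((1 + Complex.I) * s ^ 3 * p.2 + 2 * Complex.I * s ^ 6 * p.1 : ℂ).re
      = s ^ 3 * p.2 := by
    rw [← Complex.ofReal_pow, ← Complex.ofReal_pow]
    simp [-Complex.ofReal_pow]
  rw [hre]
  have h1 : s ^ 3 * p.2 ≤ c * |s| ^ 3 := by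
    calc s ^ 3 * p.2 ≤ |s ^ 3 * p.2| := le_abs_self _
      _ = |p.2| * |s| ^ 3 := by rw [abs_mul, abs_pow, mul_comm]
      _ ≤ _ := by gcongr
  calc |nullDensity s| * |s| ^ (3 * k) * Real.exp (s ^ 3 * p.2)
      ≤ (|s| ^ 5 * Real.exp (-s ^ 4)) * |s| ^ (3 * k) * Real.exp (c * |s| ^ 3) := by
        gcongr; exact abs_nullDensity_le s
    _ = _ := by ring

theorem integrable_nullKernel (k : ℕ) (p : ℝ × ℝ) :
    MeasureTheory.Integrable (nullKernel k p) :=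
  (integrable_abs_pow_mul_exp (5 + 3 * k) |p.2|).mono'
    (continuous_nullKernel k p).aestronglyMeasurable
    (MeasureTheory.ae_of_all _ fun s => norm_nullKernel_le k p le_rfl s)

theorem hasFDerivAt_nullKernel (k : ℕ) (p : ℝ × ℝ) (s : ℝ) :
    HasFDerivAt (fun q => nullKernel k q s)
      ((ContinuousLinearMap.fst ℝ ℝ ℝ).smulRight (2 * Complex.I * nullKernel (k + 2) p s) +
        (ContinuousLinearMap.snd ℝ ℝ ℝ).smulRight
          ((1 + Complex.I) * nullKernel (k + 1) p s)) p := by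
  have h2 : HasFDerivAt (fun q : ℝ × ℝ => (q.2 : ℂ))
      (Complex.ofRealCLM.comp (ContinuousLinearMap.snd ℝ ℝ ℝ)) p :=
    (Complex.ofRealCLM.comp (ContinuousLinearMap.snd ℝ ℝ ℝ)).hasFDerivAt
  have h1 : HasFDerivAt (fun q : ℝ × ℝ => (q.1 : ℂ))
      (Complex.ofRealCLM.comp (ContinuousLinearMap.fst ℝ ℝ ℝ)) p :=
    (Complex.ofRealCLM.comp (ContinuousLinearMap.fst ℝ ℝ ℝ)).hasFDerivAt
  have h := ((((h2.const_mul ((1 + Complex.I) * (s : ℂ) ^ 3)).add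
    (h1.const_mul (2 * Complex.I * (s : ℂ) ^ 6))).cexp).const_mul
      ((nullDensity s * s ^ (3 * k) : ℝ) : ℂ))
  refine h.congr_fderiv ?_
  ext
  · simp [nullKernel]; ring
  · simp [nullKernel]; ring

theorem hasFDerivAt_nullWave (k : ℕ) (p : ℝ × ℝ) :
    HasFDerivAt (nullWave k)
      ((ContinuousLinearMap.fst ℝ ℝ ℝ).smulRight (2 * Complex.I * nullWave (k + 2) p) +
        (ContinuousLinearMap.snd ℝ ℝ ℝ).smulRight ((1 + Complex.I) * nullWave (k + 1) p)) p := by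
  set F' : ℝ × ℝ → ℝ → (ℝ × ℝ →L[ℝ] ℂ) := fun q s =>
    (ContinuousLinearMap.fst ℝ ℝ ℝ).smulRight (2 * Complex.I * nullKernel (k + 2) q s) +
        (ContinuousLinearMap.snd ℝ ℝ ℝ).smulRight
          ((1 + Complex.I) * nullKernel (k + 1) q s) with hF'
  set bd : ℕ → ℝ → ℝ := fun j s =>
    |s| ^ (5 + 3 * j) * (Real.exp (-s ^ 4) * Real.exp ((|p.2| + 1) * |s| ^ 3)) with hbd
  have hbi : ∀ j, MeasureTheory.Integrable (bd j) := fun j => integrable_abs_pow_mul_exp _ _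
  have hcont : Continuous (F' p) := by
    have h1 := continuous_nullKernel (k + 1) p
    have h2 := continuous_nullKernel (k + 2) p
    have e : F' p = fun s =>
      (ContinuousLinearMap.smulRightL ℝ (ℝ × ℝ) ℂ (ContinuousLinearMap.fst ℝ ℝ ℝ))
        (2 * Complex.I * nullKernel (k + 2) p s) +
      (ContinuousLinearMap.smulRightL ℝ (ℝ × ℝ) ℂ (ContinuousLinearMap.snd ℝ ℝ ℝ))
        ((1 + Complex.I) * nullKernel (k + 1) p s) := by
      ext <;> simp [hF']
    rw [e]; fun_prop
  have hb : ∀ q ∈ Metric.ball p 1, ∀ s, ‖F' q s‖ ≤ 2 * bd (k + 2) s + 2 * bd (k + 1) s := by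
    intro q hq s
    have hq2 : |q.2| ≤ |p.2| + 1 := by
      have h1 : |q.2 - p.2| < 1 := by
        have := (Prod.dist_eq (x := q) (y := p)) ▸ Metric.mem_ball.1 hq
        exact (max_lt_iff.1 this).2
      have := abs_sub_abs_le_abs_sub q.2 p.2
      linarith
    have hI : ‖(1 + Complex.I : ℂ)‖ ≤ 2 := by
      refine (norm_add_le _ _).trans ?_
      norm_num
    have h1 := norm_nullKernel_le (k + 1) q hq2 s
    have h2 := norm_nullKernel_le (k + 2) q hq2 s
    refine (norm_add_le _ _).trans (add_le_add ?_ ?_)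
    · rw [ContinuousLinearMap.norm_smulRight_apply, norm_mul, norm_mul, Complex.norm_I]
      have := ContinuousLinearMap.norm_fst_le (𝕜 := ℝ) (E := ℝ) (F := ℝ)
      calc _ ≤ 1 * (‖(2 : ℂ)‖ * 1 * bd (k + 2) s) := by gcongr
        _ = _ := by norm_num
    · rw [ContinuousLinearMap.norm_smulRight_apply, norm_mul]
      have := ContinuousLinearMap.norm_snd_le (𝕜 := ℝ) (E := ℝ) (F := ℝ)
      calc _ ≤ 1 * (2 * bd (k + 1) s) := by gcongr
        _ = _ := by norm_num
  have hbound := ((hbi (k + 2)).const_mul 2).add ((hbi (k + 1)).const_mul 2)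
  have hint : MeasureTheory.Integrable (F' p) :=
    hbound.mono' hcont.aestronglyMeasurable
      (MeasureTheory.ae_of_all _ fun s => hb p (Metric.mem_ball_self one_pos) s)
  have main := hasFDerivAt_integral_of_dominated_of_fderiv_le (μ := MeasureTheory.volume)
    (F := nullKernel k) (F' := F') (x₀ := p) (Metric.ball_mem_nhds p one_pos)
    (Filter.Eventually.of_forall fun q => (continuous_nullKernel k q).aestronglyMeasurable)
    (integrable_nullKernel k p) hcont.aestronglyMeasurable
    (MeasureTheory.ae_of_all _ fun s q hq => hb q hq s) hbound
    (MeasureTheory.ae_of_all _ fun s q _ => hasFDerivAt_nullKernel k q s)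
  refine main.congr_fderiv ?_
  refine ContinuousLinearMap.ext fun v => ?_
  rw [ContinuousLinearMap.integral_apply hint]
  simp only [hF', _root_.add_apply, ContinuousLinearMap.smulRight_apply]
  rw [MeasureTheory.integral_add, MeasureTheory.integral_smul, MeasureTheory.integral_smul,
    MeasureTheory.integral_const_mul, MeasureTheory.integral_const_mul]
  · rfl
  · exact ((integrable_nullKernel (k + 2) p).const_mul _).smul _
  · exact ((integrable_nullKernel (k + 1) p).const_mul _).smul _

/-! ### Vanishing moments -/

/-- A cube root of `-8`. -/
def cubeRoot : ℂ := 1 + √3 * Complex.I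

theorem cubeRoot_pow_three : cubeRoot ^ 3 = -8 := by
  have h3 : ((√3 : ℝ) : ℂ) ^ 2 = 3 := by
    rw [← Complex.ofReal_pow, Real.sq_sqrt (by norm_num)]; norm_num
  unfold cubeRoot
  linear_combination (3 * Complex.I ^ 2 + √3 * Complex.I ^ 3) * h3 +
    (9 + √3 * Complex.I * 3) * Complex.I_sq

theorem cubeRoot_re : cubeRoot.re = 1 := by simp [cubeRoot]

theorem cubeRoot_ne_zero : cubeRoot ≠ 0 := by
  intro h
  have := cubeRoot_re
  simp [h] at this

/-- The integrand of the moments of `nullDensity`. -/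
def momentKernel (n : ℕ) (s : ℝ) : ℂ := (s : ℂ) ^ n * Complex.exp (-cubeRoot * (s : ℂ) ^ 4)

theorem continuous_momentKernel (n : ℕ) : Continuous (momentKernel n) := by
  unfold momentKernel; fun_prop

theorem norm_momentKernel (n : ℕ) (s : ℝ) :
    ‖momentKernel n s‖ = |s| ^ n * Real.exp (-s ^ 4) := by
  unfold momentKernel
  rw [norm_mul, norm_pow, Complex.norm_real, Complex.norm_exp, Real.norm_eq_abs]
  congr 2
  rw [← Complex.ofReal_pow, Complex.re_mul_ofReal, Complex.neg_re, cubeRoot_re, neg_one_mul]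

theorem integrable_momentKernel (n : ℕ) : MeasureTheory.Integrable (momentKernel n) :=
  (integrable_abs_pow_mul_exp n 0).mono' (continuous_momentKernel n).aestronglyMeasurable
    (MeasureTheory.ae_of_all _ fun s => by rw [norm_momentKernel]; simp)

theorem momentKernel_re (n : ℕ) (s : ℝ) :
    (momentKernel n s).re = s ^ n * (Real.exp (-s ^ 4) * Real.cos (√3 * s ^ 4)) := by
  unfold momentKernel
  rw [← Complex.ofReal_pow, ← Complex.ofReal_pow, Complex.re_ofReal_mul, Complex.exp_re]
  have h1 : (-cubeRoot * ((s ^ 4 : ℝ) : ℂ)).re = -s ^ 4 := by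
    rw [Complex.re_mul_ofReal, Complex.neg_re, cubeRoot_re, neg_one_mul]
  have h2 : (-cubeRoot * ((s ^ 4 : ℝ) : ℂ)).im = -(√3 * s ^ 4) := by
    rw [Complex.im_mul_ofReal]; simp [cubeRoot]
  rw [h1, h2, Real.cos_neg]

theorem tendsto_momentKernel (n : ℕ) : Tendsto (momentKernel n) atTop (𝓝 0) := by
  refine squeeze_zero_norm' ?_ (Real.tendsto_pow_mul_exp_neg_atTop_nhds_zero n)
  filter_upwards [eventually_ge_atTop (1 : ℝ)] with s hs
  rw [norm_momentKernel, abs_of_nonneg (by linarith)]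
  gcongr
  exact le_self_pow₀ hs (by norm_num)

theorem integral_momentKernel_add_four (n : ℕ) :
    4 * cubeRoot * ∫ s in Set.Ioi (0 : ℝ), momentKernel (n + 4) s =
      (n + 1) * ∫ s in Set.Ioi (0 : ℝ), momentKernel n s := by
  have hd : ∀ s : ℝ, HasDerivAt (momentKernel (n + 1))
      ((n + 1) * momentKernel n s - 4 * cubeRoot * momentKernel (n + 4) s) s := by
    intro s
    have h0 : HasDerivAt (fun s : ℝ => (s : ℂ)) 1 s := Complex.ofRealCLM.hasDerivAt
    have h := (h0.pow (n + 1)).mul (((h0.pow 4).const_mul (-cubeRoot)).cexp)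
    refine h.congr_deriv ?_
    simp only [momentKernel]
    push_cast
    simp
    ring
  have h1 := ((integrable_momentKernel n).const_mul ((n : ℂ) + 1)).integrableOn
    (s := Set.Ioi (0 : ℝ))
  have h2 := ((integrable_momentKernel (n + 4)).const_mul (4 * cubeRoot)).integrableOn
    (s := Set.Ioi (0 : ℝ))
  have := MeasureTheory.integral_Ioi_of_hasDerivAt_of_tendsto
    (continuous_momentKernel (n + 1)).continuousWithinAt (fun s _ => hd s) (h1.sub h2)
    (tendsto_momentKernel (n + 1)) (a := 0)
  rw [MeasureTheory.integral_sub h1 h2, MeasureTheory.integral_const_mul,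
    MeasureTheory.integral_const_mul] at this
  have h0 : momentKernel (n + 1) 0 = 0 := by simp [momentKernel]
  rw [h0, sub_zero] at this
  linear_combination -this

theorem integral_momentKernel_one_sq :
    (∫ s in Set.Ioi (0 : ℝ), momentKernel 1 s) ^ 2 = Real.pi / (16 * cubeRoot) := by
  have h := integral_gaussian_complex_Ioi (b := cubeRoot) (by rw [cubeRoot_re]; exact one_pos)
  rw [← MeasureTheory.integral_comp_rpow_Ioi_of_pos two_pos] at h
  have e : ∫ s in Set.Ioi (0 : ℝ), ((2 : ℝ) * s ^ ((2 : ℝ) - 1)) •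
        Complex.exp (-cubeRoot * ((s ^ (2 : ℝ) : ℝ) : ℂ) ^ 2)
      = 2 * ∫ s in Set.Ioi (0 : ℝ), momentKernel 1 s := by
    rw [← MeasureTheory.integral_const_mul]
    refine MeasureTheory.setIntegral_congr_fun measurableSet_Ioi fun s _ => ?_
    have h1 : s ^ ((2 : ℝ) - 1) = s := by norm_num
    rw [h1, Real.rpow_two]
    simp only [momentKernel, Complex.real_smul]
    push_cast
    ring_nf
  rw [e] at h
  have hsq : ((Real.pi / cubeRoot : ℂ) ^ (1 / 2 : ℂ)) ^ 2 = Real.pi / cubeRoot := by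
    rw [← Complex.cpow_nat_mul]
    norm_num
  have h' : (∫ s in Set.Ioi (0 : ℝ), momentKernel 1 s) =
      (Real.pi / cubeRoot : ℂ) ^ (1 / 2 : ℂ) / 4 := by
    linear_combination h / 2
  rw [h', div_pow, hsq]
  field_simp
  norm_num

theorem integral_momentKernel_re (k : ℕ) :
    (∫ s in Set.Ioi (0 : ℝ), momentKernel (12 * k + 5) s).re = 0 := by
  induction k with
  | zero =>
    have h := integral_momentKernel_add_four 1
    have hsq := integral_momentKernel_one_sq
    set z := ∫ s in Set.Ioi (0 : ℝ), momentKernel 5 s with hz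
    have hc := cubeRoot_ne_zero
    have h' : (∫ s in Set.Ioi (0 : ℝ), momentKernel 1 s) = 2 * cubeRoot * z := by
      have : (((1 : ℕ) : ℂ) + 1) = 2 := by norm_num
      rw [this] at h
      linear_combination -h / 2
    rw [h'] at hsq
    have hz2 : z ^ 2 = ((-(Real.pi / 512) : ℝ) : ℂ) := by
      have h3 := cubeRoot_pow_three
      field_simp at hsq
      push_cast
      have : z ^ 2 * cubeRoot ^ 3 * 64 = Real.pi := by linear_combination hsq
      rw [h3] at this
      linear_combination -this / 512
    have him := congrArg Complex.im hz2
    have hre := congrArg Complex.re hz2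
    rw [sq, Complex.mul_im, Complex.ofReal_im] at him
    rw [sq, Complex.mul_re, Complex.ofReal_re] at hre
    by_contra hne
    have : z.im = 0 := by
      have h2 : z.re * z.im = 0 := by linarith
      exact (mul_eq_zero.1 h2).resolve_left hne
    rw [this] at hre
    nlinarith [Real.pi_pos, sq_nonneg z.re]
  | succ k ih =>
    have h1 := integral_momentKernel_add_four (12 * k + 5)
    have h2 := integral_momentKernel_add_four (12 * k + 9)
    have h3 := integral_momentKernel_add_four (12 * k + 13)
    have e : ∫ s in Set.Ioi (0 : ℝ), momentKernel (12 * (k + 1) + 5) s =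
        ((-((12 * k + 6) * (12 * k + 10) * (12 * k + 14) / 512) : ℝ) : ℂ) *
          ∫ s in Set.Ioi (0 : ℝ), momentKernel (12 * k + 5) s := by
      have h8 := cubeRoot_pow_three
      rw [show 12 * (k + 1) + 5 = 12 * k + 13 + 4 by ring]
      rw [show 12 * k + 9 + 4 = 12 * k + 13 by ring] at h2
      rw [show 12 * k + 5 + 4 = 12 * k + 9 by ring] at h1
      generalize (∫ s in Set.Ioi (0 : ℝ), momentKernel (12 * k + 13 + 4) s) = M3 at *
      generalize (∫ s in Set.Ioi (0 : ℝ), momentKernel (12 * k + 13) s) = M2 at *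
      generalize (∫ s in Set.Ioi (0 : ℝ), momentKernel (12 * k + 9) s) = M1 at *
      generalize (∫ s in Set.Ioi (0 : ℝ), momentKernel (12 * k + 5) s) = M0 at *
      push_cast at *
      linear_combination (M3 / 8) * h8 - (cubeRoot ^ 2 / 32) * h3 -
        ((12 * k + 13 + 1) * cubeRoot / 128) * h2 -
        ((12 * k + 13 + 1) * (12 * k + 9 + 1) / 512) * h1
    rw [e, Complex.re_ofReal_mul, ih, mul_zero]

theorem integral_Ioi_moment (k : ℕ) :
    ∫ s in Set.Ioi (0 : ℝ),
      s ^ (12 * k + 5) * (Real.exp (-s ^ 4) * Real.cos (√3 * s ^ 4)) = 0 := by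
  refine Eq.trans ?_ (integral_momentKernel_re k)
  have := integral_re (𝕜 := ℂ) (integrable_momentKernel (12 * k + 5)).integrableOn.integrable
    (μ := MeasureTheory.volume.restrict (Set.Ioi (0 : ℝ)))
  simpa only [RCLike.re_eq_complex_re, momentKernel_re] using this

theorem integral_nullDensity_mul_pow (k : ℕ) : ∫ s, nullDensity s * s ^ (12 * k) = 0 := by
  have h := integral_comp_abs
    (f := fun s => s ^ (12 * k + 5) * (Real.exp (-s ^ 4) * Real.cos (√3 * s ^ 4)))
  rw [integral_Ioi_moment, mul_zero] at h
  rw [← h]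
  congr 1 with s
  have h4 : |s| ^ 4 = s ^ 4 := Even.pow_abs (by decide) s
  have h12 : |s| ^ (12 * k) = s ^ (12 * k) := Even.pow_abs ⟨6 * k, by ring⟩ s
  unfold nullDensity
  rw [pow_add, h4, h12]
  ring

theorem integral_nullDensity_mul_pow_odd {n : ℕ} (hn : Odd n) :
    ∫ s, nullDensity s * s ^ n = 0 := by
  have h := MeasureTheory.integral_neg_eq_self (fun s => nullDensity s * s ^ n)
    MeasureTheory.volume
  simp only [nullDensity_neg, hn.neg_pow, mul_neg, MeasureTheory.integral_neg] at h
  linarith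

theorem nullWave_zero_re (x : ℝ) : (nullWave 0 (0, x)).re = 0 := by
  set F : ℕ → ℝ → ℂ := fun n s =>
    ((1 + Complex.I) * x) ^ n / n.factorial * ((nullDensity s * s ^ (3 * n) : ℝ) : ℂ) with hF
  have hterm : ∀ n, (∫ s, F n s).re = 0 := by
    intro n
    rw [hF, MeasureTheory.integral_const_mul, integral_complex_ofReal]
    rcases Nat.even_or_odd n with ⟨m, hm⟩ | hn
    · rcases Nat.even_or_odd m with ⟨k, hk⟩ | ⟨k, hk⟩
      · rw [show 3 * n = 12 * k by omega, integral_nullDensity_mul_pow]; simp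
      · have e : ((1 + Complex.I) * x) ^ n / n.factorial =
            ((2 * (-4) ^ k * x ^ n / n.factorial : ℝ) : ℂ) * Complex.I := by
          rw [mul_pow, show n = 2 * (2 * k + 1) by omega, pow_mul (1 + Complex.I)]
          have : (1 + Complex.I) ^ 2 = 2 * Complex.I := by
            linear_combination Complex.I_sq
          rw [this, pow_succ, pow_mul]
          have : (2 * Complex.I) ^ 2 = -4 := by
            linear_combination 4 * Complex.I_sq
          rw [this]; push_cast; ring
        rw [e, mul_right_comm, ← Complex.ofReal_mul, Complex.re_ofReal_mul, Complex.I_re, mul_zero]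
    · have : Odd (3 * n) := (by decide : Odd 3).mul hn
      rw [integral_nullDensity_mul_pow_odd this]; simp
  have hsum : HasSum (fun n => ∫ s, F n s) (nullWave 0 (0, x)) := by
    refine MeasureTheory.hasSum_integral_of_dominated_convergence
      (fun n s => |nullDensity s| * ((2 * |x| * |s| ^ 3) ^ n / n.factorial)) ?_ ?_ ?_ ?_ ?_
    · intro n
      have := continuous_nullDensity
      exact Continuous.aestronglyMeasurable (by fun_prop)
    · refine fun n => MeasureTheory.ae_of_all _ fun s => ?_
      have hI : ‖(1 + Complex.I : ℂ)‖ ≤ 2 := (norm_add_le _ _).trans (by norm_num)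
      rw [hF]
      simp only [norm_mul, norm_div, norm_pow, Complex.norm_real, Real.norm_eq_abs,
        Complex.norm_natCast]
      calc (‖(1 + Complex.I : ℂ)‖ * |x|) ^ n / n.factorial * (|nullDensity s| * |s| ^ (3 * n))
          ≤ (2 * |x|) ^ n / n.factorial * (|nullDensity s| * |s| ^ (3 * n)) := by gcongr
        _ = _ := by rw [mul_pow _ (|s| ^ 3), pow_mul]; ring
    · exact MeasureTheory.ae_of_all _ fun s => (Real.summable_pow_div_factorial _).mul_left _
    · have e : ∀ s : ℝ, ∑' n : ℕ, |nullDensity s| * ((2 * |x| * |s| ^ 3) ^ n / n.factorial) =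
          |nullDensity s| * Real.exp (2 * |x| * |s| ^ 3) := by
        intro s
        rw [tsum_mul_left, Real.exp_eq_exp_ℝ, NormedSpace.exp_eq_tsum_div]
      simp_rw [e]
      have := continuous_nullDensity
      refine (integrable_abs_pow_mul_exp 5 (2 * |x|)).mono' (by fun_prop)
        (MeasureTheory.ae_of_all _ fun s => ?_)
      rw [Real.norm_of_nonneg (by positivity), ← mul_assoc]
      gcongr
      exact abs_nullDensity_le s
    · refine MeasureTheory.ae_of_all _ fun s => ?_
      have h := (NormedSpace.expSeries_div_hasSum_exp
        ((1 + Complex.I) * x * (s : ℂ) ^ 3)).mul_left ((nullDensity s : ℝ) : ℂ)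
      rw [← Complex.exp_eq_exp_ℂ] at h
      have e1 : (fun n => F n s) = fun n : ℕ => ((nullDensity s : ℝ) : ℂ) *
          (((1 + Complex.I) * x * (s : ℂ) ^ 3) ^ n / n.factorial) := by
        ext n
        simp only [hF]
        push_cast
        rw [mul_pow _ ((s : ℂ) ^ 3), pow_mul]; ring
      have e2 : nullKernel 0 (0, x) s =
          (nullDensity s : ℝ) * Complex.exp ((1 + Complex.I) * x * (s : ℂ) ^ 3) := by
        simp only [nullKernel]
        push_cast
        ring_nf
      rw [e1, e2]
      exact h
  have := Complex.hasSum_re hsum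
  simp only [hterm] at this
  exact this.unique hasSum_zero

/-! ### The null solution does not vanish -/

theorem hasDerivAt_nullWave_space (k : ℕ) (τ x : ℝ) :
    HasDerivAt (fun y => nullWave k (τ, y)) ((1 + Complex.I) * nullWave (k + 1) (τ, x)) x := by
  have h := (hasFDerivAt_nullWave k (τ, x)).comp_hasDerivAt x
    ((hasDerivAt_const x τ).prodMk (hasDerivAt_id x))
  refine HasDerivAt.congr_deriv h ?_
  simp

theorem hasDerivAt_nullWave_time (k : ℕ) (τ x : ℝ) :
    HasDerivAt (fun t => nullWave k (t, x)) (2 * Complex.I * nullWave (k + 2) (τ, x)) τ := by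
  have h := (hasFDerivAt_nullWave k (τ, x)).comp_hasDerivAt τ
    ((hasDerivAt_id τ).prodMk (hasDerivAt_const τ x))
  refine HasDerivAt.congr_deriv h ?_
  simp

theorem continuous_nullWave (k : ℕ) : Continuous (nullWave k) :=
  continuous_iff_continuousAt.2 fun p => (hasFDerivAt_nullWave k p).continuousAt

theorem HasDerivAt.complex_re {f : ℝ → ℂ} {f' : ℂ} {x : ℝ} (h : HasDerivAt f f' x) :
    HasDerivAt (fun y => (f y).re) f'.re x :=
  Complex.reCLM.hasFDerivAt.comp_hasDerivAt x h

/-- A solution of the heat equation, odd in space and vanishing at time `0`. -/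
def nullSol (τ x : ℝ) : ℝ := ((1 + Complex.I) * nullWave 1 (τ, x)).re

theorem hasDerivAt_nullWave_zero_re (τ x : ℝ) :
    HasDerivAt (fun y => (nullWave 0 (τ, y)).re) (nullSol τ x) x :=
  (hasDerivAt_nullWave_space 0 τ x).complex_re

theorem nullSol_zero (x : ℝ) : nullSol 0 x = 0 := by
  have h := hasDerivAt_nullWave_zero_re 0 x
  simp only [nullWave_zero_re] at h
  exact h.unique (hasDerivAt_const x 0)

theorem nullSol_neg (τ x : ℝ) : nullSol τ (-x) = -nullSol τ x := by
  have : nullWave 1 (τ, -x) = -nullWave 1 (τ, x) := by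
    unfold nullWave
    rw [← MeasureTheory.integral_neg_eq_self, ← MeasureTheory.integral_neg]
    congr 1 with s
    simp only [nullKernel, nullDensity_neg]
    push_cast
    rw [Odd.neg_pow (by decide : Odd (3 * 1)), Even.neg_pow (by decide : Even 6)]
    ring_nf
  simp only [nullSol, this]
  simp

theorem one_add_I_mul_self (z : ℂ) :
    (1 + Complex.I) * ((1 + Complex.I) * z) = 2 * Complex.I * z := by
  linear_combination z * Complex.I_sq

theorem hasDerivAt_nullSol_space (τ x : ℝ) :
    HasDerivAt (nullSol τ) (2 * Complex.I * nullWave 2 (τ, x)).re x := by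
  have h := ((hasDerivAt_nullWave_space 1 τ x).const_mul (1 + Complex.I)).complex_re
  rwa [one_add_I_mul_self] at h

theorem hasDerivAt_deriv_nullSol (τ x : ℝ) :
    HasDerivAt (deriv (nullSol τ))
      (2 * Complex.I * ((1 + Complex.I) * nullWave 3 (τ, x))).re x := by
  have e : deriv (nullSol τ) = fun y => (2 * Complex.I * nullWave 2 (τ, y)).re :=
    funext fun y => (hasDerivAt_nullSol_space τ y).deriv
  rw [e]
  exact ((hasDerivAt_nullWave_space 2 τ x).const_mul _).complex_re

theorem hasDerivAt_nullSol_time (τ x : ℝ) :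
    HasDerivAt (fun t => nullSol t x)
      (2 * Complex.I * ((1 + Complex.I) * nullWave 3 (τ, x))).re τ := by
  have h := ((hasDerivAt_nullWave_time 1 τ x).const_mul (1 + Complex.I)).complex_re
  rwa [mul_left_comm] at h

theorem differentiable_nullSol : Differentiable ℝ (fun p : ℝ × ℝ => nullSol p.1 p.2) := by
  intro p
  have h := ((hasFDerivAt_nullWave 1 p).const_mul (1 + Complex.I)).differentiableAt
  exact Complex.reCLM.differentiableAt.comp p h

theorem nullWave_zero_re_eq_integral (τ : ℝ) :
    (nullWave 0 (τ, 0)).re = ∫ s, nullDensity s * Real.cos (2 * s ^ 6 * τ) := by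
  have := integral_re (𝕜 := ℂ) (integrable_nullKernel 0 (τ, 0))
  unfold nullWave
  rw [← RCLike.re_eq_complex_re, ← this]
  congr 1 with s
  simp only [nullKernel, RCLike.re_eq_complex_re]
  rw [Complex.re_ofReal_mul, Complex.exp_re]
  have e : (1 + Complex.I) * (s : ℂ) ^ 3 * ((0 : ℝ) : ℂ) + 2 * Complex.I * (s : ℂ) ^ 6 * (τ : ℂ)
      = ((2 * s ^ 6 * τ : ℝ) : ℂ) * Complex.I := by push_cast; ring
  rw [e, Complex.re_ofReal_mul, Complex.im_ofReal_mul, Complex.I_re, Complex.I_im]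
  simp

/-- `nullDensity` after the substitution `ξ = s ^ 6`. -/
def stretchedDensity (ξ : ℝ) : ℝ :=
  Real.exp (-|ξ| ^ (2 / 3 : ℝ)) * Real.cos (√3 * |ξ| ^ (2 / 3 : ℝ))

theorem continuous_stretchedDensity : Continuous stretchedDensity := by
  have : Continuous fun ξ : ℝ => |ξ| ^ (2 / 3 : ℝ) :=
    (Real.continuous_rpow_const (by norm_num)).comp continuous_abs
  unfold stretchedDensity
  fun_prop

theorem integrable_stretchedDensity : MeasureTheory.Integrable stretchedDensity := by
  have h := integrableOn_rpow_mul_exp_neg_mul_rpow (s := 0) (p := 2 / 3) (b := 1) (by norm_num)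
    (by norm_num) one_pos
  have h2 : MeasureTheory.Integrable
      (fun ξ : ℝ => (fun r : ℝ => Real.exp (-r ^ (2 / 3 : ℝ))) ‖ξ‖) := by
    refine (MeasureTheory.integrable_fun_norm_addHaar MeasureTheory.volume
      (f := fun r : ℝ => Real.exp (-r ^ (2 / 3 : ℝ)))).2 ?_
    simpa using h
  refine h2.mono' continuous_stretchedDensity.aestronglyMeasurable
    (MeasureTheory.ae_of_all _ fun ξ => ?_)
  unfold stretchedDensity
  rw [norm_mul, Real.norm_eq_abs, Real.norm_eq_abs, Real.norm_eq_abs, Real.abs_exp]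
  exact mul_le_of_le_one_right (Real.exp_pos _).le (Real.abs_cos_le_one _)

theorem nullWave_zero_re_eq_stretched (τ : ℝ) :
    (nullWave 0 (τ, 0)).re = (∫ ξ, stretchedDensity ξ * Real.cos (2 * ξ * τ)) / 6 := by
  have h1 := integral_comp_abs (f := fun s => s ^ 5 *
    (Real.exp (-s ^ 4) * Real.cos (√3 * s ^ 4)) * Real.cos (2 * s ^ 6 * τ))
  have h2 := integral_comp_abs (f := fun ξ => Real.exp (-ξ ^ (2 / 3 : ℝ)) *
    Real.cos (√3 * ξ ^ (2 / 3 : ℝ)) * Real.cos (2 * ξ * τ))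
  have h3 := MeasureTheory.integral_comp_rpow_Ioi_of_pos (p := 6) (by norm_num)
    (g := fun ξ : ℝ => Real.exp (-ξ ^ (2 / 3 : ℝ)) *
      Real.cos (√3 * ξ ^ (2 / 3 : ℝ)) * Real.cos (2 * ξ * τ))
  have e1 : ∫ s, nullDensity s * Real.cos (2 * s ^ 6 * τ) =
      ∫ s, |s| ^ 5 * (Real.exp (-|s| ^ 4) * Real.cos (√3 * |s| ^ 4)) *
        Real.cos (2 * |s| ^ 6 * τ) := by
    congr 1 with s
    rw [Even.pow_abs (by decide : Even 4) s, Even.pow_abs (by decide : Even 6) s, nullDensity]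
  have e2 : ∫ ξ, stretchedDensity ξ * Real.cos (2 * ξ * τ) =
      ∫ ξ, Real.exp (-|ξ| ^ (2 / 3 : ℝ)) * Real.cos (√3 * |ξ| ^ (2 / 3 : ℝ)) *
        Real.cos (2 * |ξ| * τ) := by
    congr 1 with ξ
    rw [stretchedDensity]
    rcases abs_choice ξ with h | h
    · simp only [h]
    · rw [← Real.cos_neg (2 * ξ * τ), show -(2 * ξ * τ) = 2 * -ξ * τ by ring]
      simp only [h]
  have e3 : ∫ s in Set.Ioi (0 : ℝ), ((6 : ℝ) * s ^ ((6 : ℝ) - 1)) •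
      (Real.exp (-(s ^ (6 : ℝ)) ^ (2 / 3 : ℝ)) *
      Real.cos (√3 * (s ^ (6 : ℝ)) ^ (2 / 3 : ℝ)) * Real.cos (2 * s ^ (6 : ℝ) * τ)) =
      6 * ∫ s in Set.Ioi (0 : ℝ), s ^ 5 *
    (Real.exp (-s ^ 4) * Real.cos (√3 * s ^ 4)) * Real.cos (2 * s ^ 6 * τ) := by
    rw [← MeasureTheory.integral_const_mul]
    refine MeasureTheory.setIntegral_congr_fun measurableSet_Ioi fun s hs => ?_
    have hs0 : 0 ≤ s := le_of_lt hs
    have a1 : s ^ ((6 : ℝ) - 1) = s ^ 5 := by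
      rw [show ((6 : ℝ) - 1) = (5 : ℕ) by norm_num, Real.rpow_natCast]
    have a2 : (s ^ (6 : ℝ)) ^ (2 / 3 : ℝ) = s ^ 4 := by
      rw [← Real.rpow_mul hs0, show (6 : ℝ) * (2 / 3) = (4 : ℕ) by norm_num, Real.rpow_natCast]
    have a3 : s ^ (6 : ℝ) = s ^ 6 := by
      rw [show (6 : ℝ) = (6 : ℕ) by norm_num, Real.rpow_natCast]
    rw [a2, a1, a3, smul_eq_mul]
    ring
  rw [nullWave_zero_re_eq_integral, e1, e2, h1, h2, ← h3, e3]
  ring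

theorem exists_nullWave_zero_re_ne_zero : ∃ τ : ℝ, 0 ≤ τ ∧ (nullWave 0 (τ, 0)).re ≠ 0 := by
  by_contra! hall
  have hzero : ∀ τ : ℝ, ∫ ξ, stretchedDensity ξ * Real.cos (2 * ξ * τ) = 0 := by
    have hpos : ∀ τ : ℝ, 0 ≤ τ → ∫ ξ, stretchedDensity ξ * Real.cos (2 * ξ * τ) = 0 := by
      intro τ hτ
      have := hall τ hτ
      rw [nullWave_zero_re_eq_stretched] at this
      linarith
    intro τ
    rcases le_total 0 τ with h | h
    · exact hpos τ h
    · rw [← hpos (-τ) (by linarith)]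
      congr 1 with ξ
      rw [← Real.cos_neg (2 * ξ * τ), mul_neg]
  set f : ℝ → ℂ := fun ξ => (stretchedDensity ξ : ℂ) with hf
  have hfi : MeasureTheory.Integrable f := integrable_stretchedDensity.ofReal
  have hfc : Continuous f := Complex.continuous_ofReal.comp continuous_stretchedDensity
  have hF : FourierTransform.fourier f = 0 := by
    ext w
    rw [Real.fourier_real_eq_integral_exp_smul]
    set G : ℝ → ℂ := fun v => Complex.exp (↑(-2 * Real.pi * v * w) * Complex.I) • f v with hG
    have hGi : MeasureTheory.Integrable G := by
      refine hfi.mono (by fun_prop) (MeasureTheory.ae_of_all _ fun v => ?_)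
      rw [hG, norm_smul, Complex.norm_exp_ofReal_mul_I, one_mul]
    have h1 := MeasureTheory.integral_neg_eq_self G MeasureTheory.volume
    have h2 : ∫ v, (G v + G (-v)) =
        ((2 * ∫ ξ, stretchedDensity ξ * Real.cos (2 * ξ * (Real.pi * w)) : ℝ) : ℂ) := by
      rw [← MeasureTheory.integral_const_mul, ← integral_complex_ofReal]
      congr 1 with v
      have hev : stretchedDensity (-v) = stretchedDensity v := by simp [stretchedDensity]
      simp only [hG, hf, hev, smul_eq_mul, Complex.exp_mul_I, ← Complex.ofReal_cos,
        ← Complex.ofReal_sin]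
      rw [show -2 * Real.pi * v * w = -(2 * v * (Real.pi * w)) by ring,
        show -2 * Real.pi * -v * w = 2 * v * (Real.pi * w) by ring, Real.cos_neg, Real.sin_neg]
      push_cast
      ring
    rw [MeasureTheory.integral_add hGi hGi.comp_neg, h1, hzero] at h2
    simp only [mul_zero, Complex.ofReal_zero] at h2
    rw [Pi.zero_apply]
    linear_combination h2 / 2
  have hinv := hfi.fourierInv_fourier_eq (by rw [hF]; exact MeasureTheory.integrable_zero _ _ _)
    (v := 0) hfc.continuousAt
  rw [hF] at hinv
  have h0 : f 0 = 1 := by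
    simp [hf, stretchedDensity, Real.zero_rpow (show (2 / 3 : ℝ) ≠ 0 by norm_num)]
  rw [h0, Real.fourierInv_eq] at hinv
  simp at hinv

theorem exists_nullSol_pos : ∃ τ x : ℝ, 0 < τ ∧ 0 < nullSol τ x := by
  by_contra! hall
  have hz : ∀ τ, 0 ≤ τ → ∀ x, nullSol τ x = 0 := by
    intro τ hτ x
    rcases hτ.eq_or_lt with rfl | hτ
    · exact nullSol_zero x
    · have h1 := hall τ x hτ
      have h2 := hall τ (-x) hτ
      rw [nullSol_neg] at h2
      linarith
  obtain ⟨τ, hτ, hne⟩ := exists_nullWave_zero_re_ne_zero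
  apply hne
  have hd : ∀ t : ℝ, HasDerivAt (fun t => (nullWave 0 (t, 0)).re)
      (2 * Complex.I * nullWave 2 (t, 0)).re t := fun t =>
    (hasDerivAt_nullWave_time 0 t 0).complex_re
  have := constant_of_has_deriv_right_zero (f := fun t => (nullWave 0 (t, 0)).re) (a := 0) (b := τ)
    (fun t _ => (hd t).continuousAt.continuousWithinAt) (fun t ht => ?_) τ ⟨hτ, le_rfl⟩
  · exact this.trans (nullWave_zero_re 0)
  · have h := hasDerivAt_nullSol_space t 0
    rw [show nullSol t = fun _ => 0 from funext (hz t ht.1)] at h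
    have h0 := h.unique (hasDerivAt_const 0 0)
    have := (hd t).hasDerivWithinAt (s := Set.Ici t)
    rwa [h0] at this

/-! ### Successors in finite partitions -/

theorem succOf_spec {T : ℝ} {Q : Finset ℝ} {s : ℝ} (hT : T ∈ Q) (hs : s < T) :
    s < succOf T Q s ∧ succOf T Q s ∈ Q ∧ ∀ t ∈ Q, s < t → succOf T Q s ≤ t := by
  have h : (Q.filter (fun u => s < u)).Nonempty := ⟨T, Finset.mem_filter.2 ⟨hT, hs⟩⟩
  have hm := Finset.mem_filter.1 (Finset.min'_mem _ h)
  rw [succOf, dif_pos h]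
  exact ⟨hm.2, hm.1, fun t ht hst => Finset.min'_le _ _ (Finset.mem_filter.2 ⟨ht, hst⟩)⟩

theorem succOf_top {T : ℝ} {Q : Finset ℝ} (hQ : ∀ u ∈ Q, u ≤ T) : succOf T Q T = T := by
  rw [succOf, dif_neg]
  rw [Finset.not_nonempty_iff_eq_empty, Finset.filter_eq_empty_iff]
  exact fun u hu => not_lt.2 (hQ u hu)

theorem le_succOf {T : ℝ} {Q : Finset ℝ} (hT : T ∈ Q) (hQ : ∀ u ∈ Q, u ≤ T) {s : ℝ} (hs : s ≤ T) :
    s ≤ succOf T Q s := by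
  rcases hs.eq_or_lt with rfl | hs
  · exact (succOf_top hQ).ge
  · exact (succOf_spec hT hs).1.le

theorem succOf_mem {T : ℝ} {Q : Finset ℝ} (hT : T ∈ Q) (hQ : ∀ u ∈ Q, u ≤ T) {s : ℝ} (hs : s ≤ T) :
    succOf T Q s ∈ Q := by
  rcases hs.eq_or_lt with rfl | hs
  · rwa [succOf_top hQ]
  · exact (succOf_spec hT hs).2.1

theorem succOf_le_s18 {T : ℝ} {Q : Finset ℝ} {s t : ℝ} (ht : t ∈ Q)
    (hst : s < t) : succOf T Q s ≤ t := by
  have h : (Q.filter (fun u => s < u)).Nonempty := ⟨t, Finset.mem_filter.2 ⟨ht, hst⟩⟩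
  rw [succOf, dif_pos h]
  exact Finset.min'_le _ _ (Finset.mem_filter.2 ⟨ht, hst⟩)

/-- Telescoping over the points of a partition lying in `[a, b)`. -/
theorem sum_succOf_sub {T : ℝ} {Q : Finset ℝ} (hT : T ∈ Q) (hQ : ∀ u ∈ Q, u ≤ T) (f : ℝ → ℝ)
    {a b : ℝ} (ha : a ∈ Q) (hb : b ∈ Q) (hab : a ≤ b) :
    ∑ s ∈ Q.filter (fun s => a ≤ s ∧ s < b), (f (succOf T Q s) - f s) = f b - f a := by
  obtain ⟨n, hn⟩ : ∃ n, (Q.filter (fun s => a ≤ s ∧ s < b)).card = n := ⟨_, rfl⟩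
  induction n generalizing a with
  | zero =>
    rw [Finset.card_eq_zero] at hn
    rcases hab.eq_or_lt with rfl | hlt
    · rw [hn]; simp
    · exact absurd (hn ▸ Finset.mem_filter.2 ⟨ha, le_rfl, hlt⟩) (Finset.notMem_empty a)
  | succ n ih =>
    rcases hab.eq_or_lt with rfl | hlt
    · rw [Finset.filter_false_of_mem (fun s _ h => absurd h.2 (not_lt.2 h.1))]; simp
    · obtain ⟨h1, h2, h3⟩ := succOf_spec hT (hlt.trans_le (hQ b hb))
      have hset : Q.filter (fun s => a ≤ s ∧ s < b) =
          insert a (Q.filter (fun s => succOf T Q a ≤ s ∧ s < b)) := by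
        ext s
        simp only [Finset.mem_filter, Finset.mem_insert]
        constructor
        · rintro ⟨hs, has, hsb⟩
          rcases has.eq_or_lt with rfl | has
          · exact Or.inl rfl
          · exact Or.inr ⟨hs, h3 s hs has, hsb⟩
        · rintro (rfl | ⟨hs, has, hsb⟩)
          · exact ⟨ha, le_rfl, hlt⟩
          · exact ⟨hs, h1.le.trans has, hsb⟩
      have hnot : a ∉ Q.filter (fun s => succOf T Q a ≤ s ∧ s < b) := fun h =>
        absurd (Finset.mem_filter.1 h).2.1 (not_le.2 h1)
      rw [hset, Finset.card_insert_of_notMem hnot] at hn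
      rw [hset, Finset.sum_insert hnot, ih h2 (h3 b hb hlt) (by omega)]
      ring

theorem sum_filter_lt_sub (R : Finset ℝ) (g : ℝ → ℝ) {a b : ℝ} (hab : a ≤ b) :
    ∑ r ∈ R.filter (fun r => r < b), g r - ∑ r ∈ R.filter (fun r => r < a), g r =
      ∑ r ∈ R.filter (fun r => a ≤ r ∧ r < b), g r := by
  have h : R.filter (fun r => r < b) =
      R.filter (fun r => r < a) ∪ R.filter (fun r => a ≤ r ∧ r < b) := by
    ext r
    simp only [Finset.mem_union, Finset.mem_filter]
    constructor
    · rintro ⟨hr, hrb⟩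
      rcases lt_or_ge r a with h | h
      · exact Or.inl ⟨hr, h⟩
      · exact Or.inr ⟨hr, h, hrb⟩
    · rintro (⟨hr, h⟩ | ⟨hr, _, h⟩)
      · exact ⟨hr, h.trans_le hab⟩
      · exact ⟨hr, h⟩
  rw [h, Finset.sum_union, add_sub_cancel_left]
  refine Finset.disjoint_left.2 fun r h1 h2 => ?_
  exact absurd (Finset.mem_filter.1 h1).2 (not_lt.2 (Finset.mem_filter.1 h2).2.1)

/-- Grouping a sum over `R` into the blocks of a partition `Q`. -/
theorem sum_blocks {T : ℝ} {Q : Finset ℝ} (hT : T ∈ Q) (hQ : ∀ u ∈ Q, u ≤ T) (R : Finset ℝ)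
    (g : ℝ → ℝ) {a b : ℝ} (ha : a ∈ Q) (hb : b ∈ Q) (hab : a ≤ b) :
    ∑ s ∈ Q.filter (fun s => a ≤ s ∧ s < b),
      ∑ r ∈ R.filter (fun r => s ≤ r ∧ r < succOf T Q s), g r =
    ∑ r ∈ R.filter (fun r => a ≤ r ∧ r < b), g r := by
  rw [← sum_filter_lt_sub R g hab,
    ← sum_succOf_sub hT hQ (fun x => ∑ r ∈ R.filter (fun r => r < x), g r) ha hb hab]
  refine Finset.sum_congr rfl fun s hs => ?_
  exact (sum_filter_lt_sub R g (le_succOf hT hQ (hQ s (Finset.mem_filter.1 hs).1))).symm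

/-! ### Finite probability with random signs -/

theorem sum_eq_zero_of_flip {Ω : Type*} [Fintype Ω] (τ : Equiv.Perm Ω) {g : Ω → ℝ}
    (h : ∀ ω, g (τ ω) = -g ω) : ∑ ω, g ω = 0 := by
  have h1 := Equiv.sum_comp τ g
  simp only [h, Finset.sum_neg_distrib] at h1
  linarith

/-- Sign-symmetric summands are orthogonal to each other. -/
theorem sum_mul_sq_sub_eq_zero {Ω ι : Type*} [Fintype Ω] [DecidableEq ι] (B : Finset ι)
    (y : ι → Ω → ℝ) (τ : ι → Equiv.Perm Ω) (h : Ω → ℝ)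
    (hneg : ∀ i ∈ B, ∀ ω, y i (τ i ω) = -y i ω)
    (hfix : ∀ i ∈ B, ∀ j ∈ B, j ≠ i → ∀ ω, y j (τ i ω) = y j ω)
    (hh : ∀ i ∈ B, ∀ ω, h (τ i ω) = h ω) :
    ∑ ω, h ω * ((∑ i ∈ B, y i ω) ^ 2 - ∑ i ∈ B, y i ω ^ 2) = 0 := by
  induction B using Finset.induction_on with
  | empty => simp
  | insert i B hi ih =>
    have ih' := ih (fun k hk => hneg k (Finset.mem_insert_of_mem hk))
      (fun k hk j hj => hfix k (Finset.mem_insert_of_mem hk) j (Finset.mem_insert_of_mem hj))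
      (fun k hk => hh k (Finset.mem_insert_of_mem hk))
    have hi' := Finset.mem_insert_self i B
    have hcross : ∑ ω, h ω * (y i ω * ∑ j ∈ B, y j ω) = 0 := by
      refine sum_eq_zero_of_flip (τ i) fun ω => ?_
      rw [hh i hi', hneg i hi', Finset.sum_congr rfl fun j hj => hfix i hi' j
        (Finset.mem_insert_of_mem hj) (fun e => hi (e ▸ hj)) ω]
      ring
    have : ∀ ω, h ω * ((∑ j ∈ insert i B, y j ω) ^ 2 - ∑ j ∈ insert i B, y j ω ^ 2) =
        h ω * ((∑ j ∈ B, y j ω) ^ 2 - ∑ j ∈ B, y j ω ^ 2) +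
          2 * (h ω * (y i ω * ∑ j ∈ B, y j ω)) := fun ω => by
      rw [Finset.sum_insert hi, Finset.sum_insert hi]
      ring
    simp only [this, Finset.sum_add_distrib, ← Finset.mul_sum, ih', hcross]
    simp

/-- Fourth moments of sums of independent signs. -/
theorem sum_pow_four_le {Ω ι : Type*} [Fintype Ω] [DecidableEq ι] (B : Finset ι)
    (y : ι → Ω → ℝ) (τ : ι → Equiv.Perm Ω) (c : ι → ℝ)
    (hneg : ∀ i ∈ B, ∀ ω, y i (τ i ω) = -y i ω)
    (hfix : ∀ i ∈ B, ∀ j ∈ B, j ≠ i → ∀ ω, y j (τ i ω) = y j ω)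
    (hc : ∀ i ∈ B, ∀ ω, y i ω ^ 2 = c i) :
    ∑ ω, (∑ i ∈ B, y i ω) ^ 4 ≤ 3 * (∑ i ∈ B, c i) ^ 2 * Fintype.card Ω := by
  induction B using Finset.induction_on with
  | empty => simp
  | insert i B hi ih =>
    have hneg' := fun k hk => hneg k (Finset.mem_insert_of_mem (a := k) (b := i) (s := B) hk)
    have hfix' := fun k hk j hj => hfix k (Finset.mem_insert_of_mem (a := k) (b := i) (s := B) hk)
      j (Finset.mem_insert_of_mem hj)
    have hc' := fun k hk => hc k (Finset.mem_insert_of_mem (a := k) (b := i) (s := B) hk)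
    have ih' := ih hneg' hfix' hc'
    have hi' := Finset.mem_insert_self i B
    have hsq := sum_mul_sq_sub_eq_zero B y τ (fun _ => 1) hneg' hfix' (fun _ _ _ => rfl)
    have hcsum : ∀ ω, ∑ j ∈ B, y j ω ^ 2 = ∑ j ∈ B, c j := fun ω =>
      Finset.sum_congr rfl fun j hj => hc' j hj ω
    simp only [hcsum, one_mul, Finset.sum_sub_distrib, Finset.sum_const, Finset.card_univ,
      nsmul_eq_mul] at hsq
    have hcross : ∑ ω, (4 * (∑ j ∈ B, y j ω) ^ 3 * y i ω +
        4 * (∑ j ∈ B, y j ω) * y i ω ^ 3) = 0 := by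
      refine sum_eq_zero_of_flip (τ i) fun ω => ?_
      rw [hneg i hi', Finset.sum_congr rfl fun j hj => hfix i hi' j
        (Finset.mem_insert_of_mem hj) (fun e => hi (e ▸ hj)) ω]
      ring
    have hexp : ∀ ω, (∑ j ∈ insert i B, y j ω) ^ 4 = (∑ j ∈ B, y j ω) ^ 4 +
        6 * c i * (∑ j ∈ B, y j ω) ^ 2 + c i ^ 2 + (4 * (∑ j ∈ B, y j ω) ^ 3 * y i ω +
        4 * (∑ j ∈ B, y j ω) * y i ω ^ 3) := fun ω => by
      rw [Finset.sum_insert hi, ← hc i hi' ω]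
      ring
    simp only [hexp]
    rw [Finset.sum_add_distrib, hcross, Finset.sum_add_distrib, Finset.sum_add_distrib,
      ← Finset.mul_sum, sub_eq_zero.1 hsq, Finset.sum_insert hi]
    simp only [Finset.sum_const, Finset.card_univ, nsmul_eq_mul]
    nlinarith [mul_nonneg (sq_nonneg (c i)) (Nat.cast_nonneg (α := ℝ) (Fintype.card Ω))]

/-- A maximal inequality: `Y` dominates each `X i` on the event that `i` is the first index
with `l ≤ |X i|`. -/
theorem maximal_inequality {Ω ι : Type*} [Fintype Ω] [DecidableEq Ω] (F : Finset ι) (κ : ι → ℝ)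
    (hκ : Function.Injective κ) (X : ι → Ω → ℝ) (Y : Ω → ℝ) {l : ℝ} (hl : 0 ≤ l) {p : ℕ}
    (hp : Even p)
    (hX : ∀ i ∈ F, ∀ A : Finset Ω,
      A = Finset.univ.filter (fun ω => l ≤ |X i ω| ∧ ∀ j ∈ F, κ j < κ i → |X j ω| < l) →
      ∑ ω ∈ A, X i ω ^ p ≤ ∑ ω ∈ A, Y ω ^ p) :
    (Finset.univ.filter (fun ω => ∃ i ∈ F, l ≤ |X i ω|)).card * l ^ p ≤ ∑ ω, Y ω ^ p := by
  set A : ι → Finset Ω := fun i =>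
    Finset.univ.filter (fun ω => l ≤ |X i ω| ∧ ∀ j ∈ F, κ j < κ i → |X j ω| < l) with hA
  have hdisj : (F : Set ι).PairwiseDisjoint A := by
    intro i hi j hj hij
    refine Finset.disjoint_left.2 fun ω h1 h2 => ?_
    have h1 := (Finset.mem_filter.1 h1).2
    have h2 := (Finset.mem_filter.1 h2).2
    rcases lt_or_gt_of_ne (fun e => hij (hκ e) : κ i ≠ κ j) with h | h
    · exact absurd h1.1 (not_le.2 (h2.2 i hi h))
    · exact absurd h2.1 (not_le.2 (h1.2 j hj h))
  have hsub : Finset.univ.filter (fun ω => ∃ i ∈ F, l ≤ |X i ω|) ⊆ F.biUnion A := by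
    intro ω hω
    obtain ⟨i, hi, hli⟩ := (Finset.mem_filter.1 hω).2
    obtain ⟨i₀, hi₀, hmin⟩ := Finset.exists_min_image (F.filter fun i => l ≤ |X i ω|) κ
      ⟨i, Finset.mem_filter.2 ⟨hi, hli⟩⟩
    have hi₀ := Finset.mem_filter.1 hi₀
    refine Finset.mem_biUnion.2 ⟨i₀, hi₀.1, Finset.mem_filter.2 ⟨Finset.mem_univ _, hi₀.2, ?_⟩⟩
    intro j hj hji
    by_contra! hlt
    exact absurd (hmin j (Finset.mem_filter.2 ⟨hj, hlt⟩)) (not_le.2 hji)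
  have hpt : ∀ i ∈ F, ∑ _ω ∈ A i, l ^ p ≤ ∑ ω ∈ A i, Y ω ^ p := fun i hi => by
    refine le_trans (Finset.sum_le_sum fun ω hω => ?_) (hX i hi _ rfl)
    rw [← hp.pow_abs (X i ω)]
    exact pow_le_pow_left₀ hl (Finset.mem_filter.1 hω).2.1 p
  calc ((Finset.univ.filter (fun ω => ∃ i ∈ F, l ≤ |X i ω|)).card : ℝ) * l ^ p
      ≤ (F.biUnion A).card * l ^ p := by
        have := Finset.card_le_card hsub
        gcongr
    _ = ∑ i ∈ F, ∑ _ω ∈ A i, l ^ p := by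
        rw [← Finset.sum_biUnion hdisj, Finset.sum_const, nsmul_eq_mul]
    _ ≤ ∑ i ∈ F, ∑ ω ∈ A i, Y ω ^ p := Finset.sum_le_sum hpt
    _ = ∑ ω ∈ F.biUnion A, Y ω ^ p := (Finset.sum_biUnion hdisj).symm
    _ ≤ ∑ ω, Y ω ^ p :=
        Finset.sum_le_sum_of_subset_of_nonneg (Finset.subset_univ _) fun ω _ _ => hp.pow_nonneg _

/-- A random walk on the partition `P`: `inc a b` is its increment over `[a, b)`, and `flip c d`
is the measure-preserving map which reflects the steps in `[c, d)`. -/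
structure SignWalk (T : ℝ) (P : Finset ℝ) (Ω : Type) where
  inc : ℝ → ℝ → Ω → ℝ
  flip : ℝ → ℝ → Equiv.Perm Ω
  inc_add : ∀ {a b c : ℝ} (ω : Ω), a ≤ b → b ≤ c → inc a b ω + inc b c ω = inc a c ω
  inc_flip_neg : ∀ {a b c d : ℝ} (ω : Ω), c ≤ a → b ≤ d → inc a b (flip c d ω) = -inc a b ω
  inc_flip_self : ∀ {a b c d : ℝ} (ω : Ω), b ≤ c ∨ d ≤ a → inc a b (flip c d ω) = inc a b ω
  inc_sq : ∀ u ∈ P, ∀ ω, inc u (succOf T P u) ω ^ 2 = 2 * (succOf T P u - u)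
  inc_eq_zero : ∀ {a b : ℝ} (ω : Ω), (∀ u ∈ P, a ≤ u → b ≤ u) → inc a b ω = 0

/-- The walk with independent steps `± √(2 (u' - u))`. -/
def signWalk {T : ℝ} {P : Finset ℝ} (hT : T ∈ P) (hP : ∀ u ∈ P, u ≤ T) :
    SignWalk T P (P → ℤˣ) where
  inc a b ω := ∑ u : P, if a ≤ (u : ℝ) ∧ (u : ℝ) < b then
    ((ω u : ℤ) : ℝ) * √(2 * (succOf T P u - u)) else 0
  flip c d := Equiv.mulLeft fun u : P => if c ≤ (u : ℝ) ∧ (u : ℝ) < d then -1 else 1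
  inc_add {a b c} ω hab hbc := by
    rw [← Finset.sum_add_distrib]
    refine Finset.sum_congr rfl fun u _ => ?_
    by_cases h1 : (u : ℝ) < b
    · simp [h1, h1.trans_le hbc, not_le.2 h1]
    · simp [h1, not_lt.1 h1, hab.trans (not_lt.1 h1)]
  inc_flip_neg {a b c d} ω hca hbd := by
    rw [← Finset.sum_neg_distrib]
    refine Finset.sum_congr rfl fun u _ => ?_
    by_cases h : a ≤ (u : ℝ) ∧ (u : ℝ) < b
    · simp [h, hca.trans h.1, h.2.trans_le hbd]
    · simp [h]
  inc_flip_self {a b c d} ω hd := by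
    refine Finset.sum_congr rfl fun u _ => ?_
    by_cases h : a ≤ (u : ℝ) ∧ (u : ℝ) < b
    · have : ¬ (c ≤ (u : ℝ) ∧ (u : ℝ) < d) := by
        rintro ⟨h1, h2⟩
        rcases hd with hd | hd
        · linarith [h.2]
        · linarith [h.1]
      simp [h, this]
    · simp [h]
  inc_sq u hu ω := by
    have hle := le_succOf hT hP (hP u hu)
    rw [Finset.sum_eq_single (⟨u, hu⟩ : P)]
    · rcases hle.eq_or_lt with h | h
      · simp [← h]
      · simp only [le_refl, h, and_self, if_true, mul_pow]
        rw [Real.sq_sqrt (by linarith), ← Int.cast_pow, ← Units.val_pow_eq_pow_val,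
          Int.units_sq]
        simp
    · intro v _ hv
      rw [if_neg]
      rintro ⟨h1, h2⟩
      rcases h1.eq_or_lt with h1 | h1
      · exact hv (Subtype.ext h1.symm)
      · exact absurd (succOf_le_s18 v.2 h1) (not_le.2 h2)
    · exact fun h => absurd (Finset.mem_univ _) h
  inc_eq_zero {a b} ω h := by
    refine Finset.sum_eq_zero fun u _ => if_neg fun hu => ?_
    exact absurd (h u u.2 hu.1) (not_le.2 hu.2)

namespace SignWalk

variable {T : ℝ} {P : Finset ℝ} {Ω : Type}

theorem inc_self (W : SignWalk T P Ω) (a : ℝ) (ω : Ω) : W.inc a a ω = 0 :=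
  W.inc_eq_zero ω fun _ _ h => h

theorem inc_eq_sub (W : SignWalk T P Ω) {a b : ℝ} (ha : 0 ≤ a) (hab : a ≤ b) (ω : Ω) :
    W.inc a b ω = W.inc 0 b ω - W.inc 0 a ω := by
  rw [← W.inc_add ω ha hab, add_sub_cancel_left]

theorem sum_inc (W : SignWalk T P Ω) {Q : Finset ℝ} (hT : T ∈ Q) (hQ : ∀ u ∈ Q, u ≤ T) {a b : ℝ}
    (ha : a ∈ Q) (hb : b ∈ Q) (hab : a ≤ b) (ω : Ω) :
    ∑ s ∈ Q.filter (fun s => a ≤ s ∧ s < b), W.inc s (succOf T Q s) ω = W.inc a b ω := by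
  have h := sum_succOf_sub hT hQ (fun x => W.inc a x ω) ha hb hab
  simp only [W.inc_self, sub_zero] at h
  rw [← h]
  refine Finset.sum_congr rfl fun s hs => ?_
  have hs := Finset.mem_filter.1 hs
  rw [← W.inc_add ω hs.2.1 (le_succOf hT hQ (hQ s hs.1)), add_sub_cancel_left]

theorem inc_succOf_flip_neg (W : SignWalk T P Ω) (Q : Finset ℝ) (s : ℝ) (ω : Ω) :
    W.inc s (succOf T Q s) (W.flip s (succOf T Q s) ω) = -W.inc s (succOf T Q s) ω :=
  W.inc_flip_neg ω le_rfl le_rfl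

theorem inc_succOf_flip_self (W : SignWalk T P Ω) {Q : Finset ℝ} {s r : ℝ}
    (hs : s ∈ Q) (hr : r ∈ Q) (hsr : s ≠ r) (ω : Ω) :
    W.inc s (succOf T Q s) (W.flip r (succOf T Q r) ω) = W.inc s (succOf T Q s) ω := by
  refine W.inc_flip_self ω ?_
  rcases lt_or_gt_of_ne hsr with h | h
  · exact Or.inl (succOf_le_s18 hr h)
  · exact Or.inr (succOf_le_s18 hs h)

/-- Flipping a block of a partition only changes the signs of the increments of a refinement. -/
theorem inc_succOf_flip_sq (W : SignWalk T P Ω) {Q R : Finset ℝ} (hT : T ∈ Q)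
    (hQ : ∀ u ∈ Q, u ≤ T) (hQR : Q ⊆ R) {s r : ℝ} (hr : r ∈ Q)
    (ω : Ω) :
    W.inc s (succOf T R s) (W.flip r (succOf T Q r) ω) ^ 2 = W.inc s (succOf T R s) ω ^ 2 := by
  rcases lt_or_ge s r with h | h
  · rw [W.inc_flip_self ω (Or.inl (succOf_le_s18 (hQR hr) h))]
  rcases lt_or_ge s (succOf T Q r) with h' | h'
  · rw [W.inc_flip_neg ω h (succOf_le_s18 (hQR (succOf_mem hT hQ (hQ r hr))) h'), neg_sq]
  · rw [W.inc_flip_self ω (Or.inr h')]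

theorem sum_inc_sq_fine (W : SignWalk T P Ω) (hT : T ∈ P) (hP : ∀ u ∈ P, u ≤ T) {a b : ℝ}
    (ha : a ∈ P) (hb : b ∈ P) (hab : a ≤ b) (ω : Ω) :
    ∑ r ∈ P.filter (fun r => a ≤ r ∧ r < b), W.inc r (succOf T P r) ω ^ 2 = 2 * (b - a) := by
  rw [← sum_succOf_sub hT hP (fun x => x) ha hb hab, Finset.mul_sum]
  exact Finset.sum_congr rfl fun r hr => W.inc_sq r (Finset.mem_filter.1 hr).1 ω

/-- The error of the quadratic variation of the walk along `Q` at time `t`. -/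
def qvErr (W : SignWalk T P Ω) (Q : Finset ℝ) (t : ℝ) (ω : Ω) : ℝ :=
  ∑ s ∈ Q.filter (fun s => 0 ≤ s ∧ s < t), W.inc s (succOf T Q s) ω ^ 2 - 2 * t

theorem qvErr_eq_sum (W : SignWalk T P Ω) {Q : Finset ℝ} (hT : T ∈ Q) (hQ : ∀ u ∈ Q, u ≤ T)
    {t : ℝ} (h0 : 0 ∈ Q) (ht : t ∈ Q) (ht0 : 0 ≤ t) (ω : Ω) :
    W.qvErr Q t ω = ∑ s ∈ Q.filter (fun s => 0 ≤ s ∧ s < t),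
      (W.inc s (succOf T Q s) ω ^ 2 - 2 * (succOf T Q s - s)) := by
  rw [Finset.sum_sub_distrib, ← Finset.mul_sum, sum_succOf_sub hT hQ (fun x => x) h0 ht ht0,
    sub_zero, qvErr]

theorem qvErr_sub_qvErr (W : SignWalk T P Ω) {Q : Finset ℝ} (hT : T ∈ Q) (hQ : ∀ u ∈ Q, u ≤ T)
    (R : Finset ℝ) {t : ℝ} (h0 : 0 ∈ Q) (ht : t ∈ Q) (ht0 : 0 ≤ t) (ω : Ω) :
    W.qvErr Q t ω - W.qvErr R t ω = ∑ s ∈ Q.filter (fun s => 0 ≤ s ∧ s < t),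
      (W.inc s (succOf T Q s) ω ^ 2 -
        ∑ r ∈ R.filter (fun r => s ≤ r ∧ r < succOf T Q s), W.inc r (succOf T R r) ω ^ 2) := by
  rw [Finset.sum_sub_distrib, sum_blocks hT hQ R _ h0 ht ht0, qvErr, qvErr]
  ring

theorem qvErr_flip (W : SignWalk T P Ω) {Q R : Finset ℝ} (hT : T ∈ Q)
    (hQ : ∀ u ∈ Q, u ≤ T) (hQR : Q ⊆ R) {r : ℝ} (hr : r ∈ Q) (t : ℝ) (ω : Ω) :
    W.qvErr R t (W.flip r (succOf T Q r) ω) = W.qvErr R t ω := by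
  simp only [qvErr, W.inc_succOf_flip_sq hT hQ hQR hr]

variable [Fintype Ω]

theorem sum_mul_inc_sq_sub_eq_zero (W : SignWalk T P Ω) {Q : Finset ℝ} (hT : T ∈ Q)
    (hQ : ∀ u ∈ Q, u ≤ T) {a b : ℝ} (ha : a ∈ Q) (hb : b ∈ Q) (hab : a ≤ b) (h : Ω → ℝ)
    (hh : ∀ r ∈ Q, a ≤ r → r < b → ∀ ω, h (W.flip r (succOf T Q r) ω) = h ω) :
    ∑ ω, h ω * (W.inc a b ω ^ 2 -
      ∑ r ∈ Q.filter (fun r => a ≤ r ∧ r < b), W.inc r (succOf T Q r) ω ^ 2) = 0 := by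
  simp only [← W.sum_inc hT hQ ha hb hab]
  refine sum_mul_sq_sub_eq_zero _ _ (fun r => W.flip r (succOf T Q r)) h
    (fun r _ => W.inc_succOf_flip_neg Q r) (fun r hr s hs hsr => ?_) (fun r hr => ?_)
  · exact W.inc_succOf_flip_self (Finset.mem_filter.1 hs).1 (Finset.mem_filter.1 hr).1 hsr
  · have hr := Finset.mem_filter.1 hr
    exact hh r hr.1 hr.2.1 hr.2.2

theorem sum_mul_inc_sq_eq_zero (W : SignWalk T P Ω) (hT : T ∈ P)
    (hP : ∀ u ∈ P, u ≤ T) {a b : ℝ} (ha : a ∈ P) (hb : b ∈ P) (hab : a ≤ b) (h : Ω → ℝ)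
    (hh : ∀ r ∈ P, a ≤ r → r < b → ∀ ω, h (W.flip r (succOf T P r) ω) = h ω) :
    ∑ ω, h ω * (W.inc a b ω ^ 2 - 2 * (b - a)) = 0 := by
  simpa only [W.sum_inc_sq_fine hT hP ha hb hab] using
    W.sum_mul_inc_sq_sub_eq_zero hT hP ha hb hab h hh

theorem sum_inc_pow_four_le (W : SignWalk T P Ω) (hT : T ∈ P) (hP : ∀ u ∈ P, u ≤ T) {a b : ℝ}
    (ha : a ∈ P) (hb : b ∈ P) (hab : a ≤ b) :
    ∑ ω, W.inc a b ω ^ 4 ≤ 12 * (b - a) ^ 2 * Fintype.card Ω := by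
  have h := sum_pow_four_le (P.filter (fun r => a ≤ r ∧ r < b))
    (fun r => W.inc r (succOf T P r)) (fun r => W.flip r (succOf T P r))
    (fun r => 2 * (succOf T P r - r))
    (fun r _ => W.inc_succOf_flip_neg P r)
    (fun r hr s hs hsr => W.inc_succOf_flip_self (Finset.mem_filter.1 hs).1
      (Finset.mem_filter.1 hr).1 hsr)
    (fun r hr => W.inc_sq r (Finset.mem_filter.1 hr).1)
  rw [← Finset.mul_sum, sum_succOf_sub hT hP (fun x => x) ha hb hab] at h
  simp only [W.sum_inc hT hP ha hb hab] at h
  linarith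

/-- The maximum of the walk over a block. -/
theorem card_exists_le_inc (W : SignWalk T P Ω) (hT : T ∈ P) (hP : ∀ u ∈ P, u ≤ T) {a b l : ℝ}
    (hl : 0 ≤ l) (ha : a ∈ P) (hb : b ∈ P) (hab : a ≤ b) :
    (Finset.univ.filter (fun ω => ∃ d ∈ P.filter (fun d => a ≤ d ∧ d ≤ b),
      l ≤ |W.inc a d ω|)).card * l ^ 4 ≤ 12 * (b - a) ^ 2 * Fintype.card Ω := by
  classical
  refine le_trans (maximal_inequality (P.filter (fun d => a ≤ d ∧ d ≤ b)) (fun d => d)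
    Function.injective_id (fun d => W.inc a d) (W.inc a b) hl (by decide) ?_)
    (W.sum_inc_pow_four_le hT hP ha hb hab)
  intro d hd A hA
  obtain ⟨had, hdb⟩ := (Finset.mem_filter.1 hd).2
  have hflip : ∀ {c : ℝ} (ω : Ω), c ≤ d → W.inc a c (W.flip d b ω) = W.inc a c ω :=
    fun ω hc => W.inc_flip_self ω (Or.inl hc)
  have hmem : ∀ ω, W.flip d b ω ∈ A ↔ ω ∈ A := fun ω => by
    rw [hA, Finset.mem_filter, Finset.mem_filter, hflip ω le_rfl]
    refine and_congr (by simp) (and_congr_right fun _ => forall₂_congr fun c _ => ?_)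
    exact imp_congr_right fun hc => by rw [hflip ω hc.le]
  have hsum : ∑ ω ∈ A, W.inc a b ω ^ 4 = ∑ ω ∈ A, (W.inc a d ω - W.inc d b ω) ^ 4 := by
    refine (Finset.sum_equiv (W.flip d b) (fun ω => (hmem ω).symm) fun ω _ => ?_).symm
    rw [← W.inc_add _ had hdb, hflip ω le_rfl, W.inc_flip_neg ω le_rfl le_rfl, sub_eq_add_neg]
  have hle : ∑ ω ∈ A, 2 * W.inc a d ω ^ 4 ≤
      ∑ ω ∈ A, (W.inc a b ω ^ 4 + (W.inc a d ω - W.inc d b ω) ^ 4) := by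
    refine Finset.sum_le_sum fun ω _ => ?_
    rw [← W.inc_add ω had hdb]
    nlinarith [sq_nonneg (W.inc a d ω * W.inc d b ω), sq_nonneg (W.inc d b ω ^ 2)]
  rw [Finset.sum_add_distrib, ← hsum, ← Finset.mul_sum] at hle
  linarith

theorem sum_qvErr_sq_le (W : SignWalk T P Ω) (hP : ∀ u ∈ P, u ≤ T) {Q : Finset ℝ} (hT : T ∈ Q)
    (hQP : Q ⊆ P) {t δ : ℝ} (h0 : 0 ∈ Q) (ht : t ∈ Q) (ht0 : 0 ≤ t)
    (hδ : ∀ s ∈ Q, succOf T Q s - s ≤ δ) :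
    ∑ ω, W.qvErr Q t ω ^ 2 ≤ 16 * δ * T * Fintype.card Ω := by
  have hQ : ∀ u ∈ Q, u ≤ T := fun u hu => hP u (hQP hu)
  have hTP := hQP hT
  set B := Q.filter (fun s => 0 ≤ s ∧ s < t) with hB
  have hBQ : ∀ s ∈ B, s ∈ Q := fun s hs => (Finset.mem_filter.1 hs).1
  have hle : ∀ s ∈ B, s ≤ succOf T Q s := fun s hs => le_succOf hT hQ (hQ s (hBQ s hs))
  have hsucc : ∀ s ∈ B, succOf T Q s ∈ P := fun s hs => hQP (succOf_mem hT hQ (hQ s (hBQ s hs)))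
  set z : ℝ → Ω → ℝ := fun s ω => W.inc s (succOf T Q s) ω ^ 2 - 2 * (succOf T Q s - s) with hz
  have horth : ∀ s ∈ B, ∀ r ∈ B, r ≠ s → ∑ ω, z s ω * z r ω = 0 := by
    intro s hs r hr hrs
    refine W.sum_mul_inc_sq_eq_zero hTP hP (hQP (hBQ r hr)) (hsucc r hr) (hle r hr) (z s) ?_
    intro u hu hru hur ω
    have : W.inc s (succOf T Q s) (W.flip u (succOf T P u) ω) = W.inc s (succOf T Q s) ω := by
      refine W.inc_flip_self ω ?_
      rcases lt_or_gt_of_ne hrs with h | h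
      · exact Or.inr ((succOf_le_s18 (hsucc r hr) hur).trans (succOf_le_s18 (hBQ s hs) h))
      · exact Or.inl ((succOf_le_s18 (hBQ r hr) h).trans hru)
    simp only [hz, this]
  have hsq : ∀ s ∈ B, ∑ ω, z s ω ^ 2 ≤ 16 * δ * (succOf T Q s - s) * Fintype.card Ω := by
    intro s hs
    have hs0 := sub_nonneg.2 (hle s hs)
    have h4 := W.sum_inc_pow_four_le hTP hP (hQP (hBQ s hs)) (hsucc s hs) (hle s hs)
    have hpt : ∑ ω, z s ω ^ 2 ≤
        ∑ ω, (W.inc s (succOf T Q s) ω ^ 4 + 4 * (succOf T Q s - s) ^ 2) := by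
      refine Finset.sum_le_sum fun ω _ => ?_
      simp only [hz]
      nlinarith [mul_nonneg hs0 (sq_nonneg (W.inc s (succOf T Q s) ω))]
    rw [Finset.sum_add_distrib, Finset.sum_const, Finset.card_univ, nsmul_eq_mul] at hpt
    have hmul : (succOf T Q s - s) ^ 2 * Fintype.card Ω ≤
        δ * (succOf T Q s - s) * Fintype.card Ω := by
      rw [pow_two]
      have := hδ s (hBQ s hs)
      gcongr
    linarith
  have hδ0 : 0 ≤ δ := by simpa [succOf_top hQ] using hδ T hT
  calc ∑ ω, W.qvErr Q t ω ^ 2 = ∑ ω, ∑ s ∈ B, ∑ r ∈ B, z s ω * z r ω := by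
        refine Finset.sum_congr rfl fun ω _ => ?_
        rw [W.qvErr_eq_sum hT hQ h0 ht ht0, pow_two, Finset.sum_mul_sum]
    _ = ∑ s ∈ B, ∑ r ∈ B, ∑ ω, z s ω * z r ω := by
        rw [Finset.sum_comm]
        exact Finset.sum_congr rfl fun s _ => Finset.sum_comm
    _ = ∑ s ∈ B, ∑ ω, z s ω ^ 2 := by
        refine Finset.sum_congr rfl fun s hs => ?_
        rw [Finset.sum_eq_single_of_mem s hs (horth s hs)]
        simp only [pow_two]
    _ ≤ ∑ s ∈ B, 16 * δ * (succOf T Q s - s) * Fintype.card Ω := Finset.sum_le_sum hsq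
    _ = 16 * δ * t * Fintype.card Ω := by
        rw [← Finset.sum_mul, ← Finset.mul_sum, sum_succOf_sub hT hQ (fun x => x) h0 ht ht0,
          sub_zero]
    _ ≤ 16 * δ * T * Fintype.card Ω := by
        have := hQ t ht
        gcongr

/-- The quadratic variations along a refining sequence form a reverse martingale. -/
theorem card_exists_le_qvErr (W : SignWalk T P Ω) (hP : ∀ u ∈ P, u ≤ T) {Q : ℕ → Finset ℝ}
    (hmono : Monotone Q) {m N : ℕ} (hT : T ∈ Q m) (hQP : ∀ j, j ≤ N → Q j ⊆ P) (hmN : m ≤ N)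
    {t δ l : ℝ} (hl : 0 ≤ l) (h0 : 0 ∈ Q m) (ht : t ∈ Q m) (ht0 : 0 ≤ t)
    (hδ : ∀ s ∈ Q m, succOf T (Q m) s - s ≤ δ) :
    (Finset.univ.filter (fun ω => ∃ j ∈ Finset.Icc m N, l ≤ |W.qvErr (Q j) t ω|)).card * l ^ 2 ≤
      16 * δ * T * Fintype.card Ω := by
  classical
  have hQm : ∀ u ∈ Q m, u ≤ T := fun u hu => hP u (hQP m hmN hu)
  refine le_trans (maximal_inequality (Finset.Icc m N) (fun j : ℕ => -(j : ℝ))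
    (fun i j h => Nat.cast_injective (neg_injective h)) (fun j => W.qvErr (Q j) t)
    (W.qvErr (Q m) t) hl (by decide) ?_) (W.sum_qvErr_sq_le hP hT (hQP m hmN) h0 ht ht0 hδ)
  intro j hj A hA
  obtain ⟨hmj, hjN⟩ := Finset.mem_Icc.1 hj
  have hQj : ∀ u ∈ Q j, u ≤ T := fun u hu => hP u (hQP j hjN hu)
  have hTj := hmono hmj hT
  have hflip : ∀ i, j ≤ i → ∀ r ∈ Q j, ∀ ω,
      W.qvErr (Q i) t (W.flip r (succOf T (Q j) r) ω) = W.qvErr (Q i) t ω :=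
    fun i hi r hr ω => W.qvErr_flip hTj hQj (hmono hi) hr t ω
  have hmem : ∀ r ∈ Q j, ∀ ω, W.flip r (succOf T (Q j) r) ω ∈ A ↔ ω ∈ A := fun r hr ω => by
    rw [hA, Finset.mem_filter, Finset.mem_filter, hflip j le_rfl r hr]
    refine and_congr (by simp) (and_congr_right fun _ => forall₂_congr fun i _ => ?_)
    refine imp_congr_right fun hi => ?_
    rw [hflip i (by exact_mod_cast (neg_lt_neg_iff.1 hi).le) r hr]
  have hcross : ∑ ω ∈ A, W.qvErr (Q j) t ω * (W.qvErr (Q m) t ω - W.qvErr (Q j) t ω) = 0 := by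
    set h : Ω → ℝ := fun ω => if ω ∈ A then W.qvErr (Q j) t ω else 0 with hh
    have : ∑ ω ∈ A, W.qvErr (Q j) t ω * (W.qvErr (Q m) t ω - W.qvErr (Q j) t ω) =
        ∑ ω, h ω * (W.qvErr (Q m) t ω - W.qvErr (Q j) t ω) := by
      simp only [hh, ite_mul, zero_mul, Finset.sum_ite_mem, Finset.univ_inter]
    rw [this]
    simp only [W.qvErr_sub_qvErr hT hQm (Q j) h0 ht ht0, Finset.mul_sum]
    rw [Finset.sum_comm]
    refine Finset.sum_eq_zero fun s hs => ?_
    have hs := (Finset.mem_filter.1 hs).1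
    refine W.sum_mul_inc_sq_sub_eq_zero hTj hQj (hmono hmj hs)
      (hmono hmj (succOf_mem hT hQm (hQm s hs))) (le_succOf hT hQm (hQm s hs)) h ?_
    intro r hr _ _ ω
    simp only [hh, hmem r hr, hflip j le_rfl r hr]
  have : ∑ ω ∈ A, (W.qvErr (Q j) t ω ^ 2 +
      2 * (W.qvErr (Q j) t ω * (W.qvErr (Q m) t ω - W.qvErr (Q j) t ω))) ≤
      ∑ ω ∈ A, W.qvErr (Q m) t ω ^ 2 := by
    refine Finset.sum_le_sum fun ω _ => ?_
    nlinarith [sq_nonneg (W.qvErr (Q m) t ω - W.qvErr (Q j) t ω)]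
  rwa [Finset.sum_add_distrib, ← Finset.mul_sum, hcross, mul_zero, add_zero] at this

end SignWalk

namespace SignWalk

variable {T : ℝ} {P : Finset ℝ} {Ω : Type}

theorem abs_inc_lt (W : SignWalk T P Ω) {a b l : ℝ} {ω : Ω} (hb : b ∈ P)
    (h : ∀ d ∈ P.filter (fun d => a ≤ d ∧ d ≤ b), |W.inc a d ω| < l) {x : ℝ}
    (hax : a ≤ x) (hxb : x ≤ b) : |W.inc a x ω| < l := by
  obtain ⟨d, hd, hmin⟩ := Finset.exists_min_image (P.filter (fun u => x ≤ u)) (fun u => u)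
    ⟨b, Finset.mem_filter.2 ⟨hb, hxb⟩⟩
  have hd := Finset.mem_filter.1 hd
  have hz : W.inc x d ω = 0 :=
    W.inc_eq_zero ω fun u hu hxu => hmin u (Finset.mem_filter.2 ⟨hu, hxu⟩)
  have := h d (Finset.mem_filter.2 ⟨hd.1, hax.trans hd.2, hmin b (Finset.mem_filter.2 ⟨hb, hxb⟩)⟩)
  rwa [← W.inc_add ω hax hd.2, hz, add_zero] at this

end SignWalk

namespace PartitionSeq

variable {T : ℝ}

theorem monotone_part (𝕋 : PartitionSeq T) : Monotone 𝕋.part := monotone_nat_of_le_succ 𝕋.refining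

theorem nonneg (𝕋 : PartitionSeq T) {n : ℕ} {s : ℝ} (hs : s ∈ 𝕋.part n) : 0 ≤ s :=
  (𝕋.subset_Icc n hs).1

theorem le_top (𝕋 : PartitionSeq T) {n : ℕ} : ∀ s ∈ 𝕋.part n, s ≤ T :=
  fun _ hs => (𝕋.subset_Icc n hs).2

/-- Tolerance of the `k`-th approximation step. -/
def tol (k : ℕ) : ℝ := 1 / ((k : ℝ) + 1)

theorem tol_pos (k : ℕ) : 0 < tol k := Nat.one_div_pos_of_nat

theorem exists_levels (hT : 0 < T) (𝕋 : PartitionSeq T) :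
    ∃ (m : ℕ → ℕ) (δ : ℕ → ℝ), ∀ k, k ≤ m k ∧
      (∀ s ∈ 𝕋.part (m k), succOf T (𝕋.part (m k)) s - s ≤ δ k) ∧
      12 * δ k * T / tol k ^ 4 + (𝕋.part k).card * (16 * δ k * T / tol k ^ 2) ≤
        (1 / 2) ^ k / 4 := by
  have h : ∀ k, ∃ (m : ℕ) (δ : ℝ), k ≤ m ∧
      (∀ s ∈ 𝕋.part m, succOf T (𝕋.part m) s - s ≤ δ) ∧
      12 * δ * T / tol k ^ 4 + (𝕋.part k).card * (16 * δ * T / tol k ^ 2) ≤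
        (1 / 2) ^ k / 4 := by
    intro k
    have hk := tol_pos k
    set c : ℝ := 12 * T / tol k ^ 4 + (𝕋.part k).card * (16 * T / tol k ^ 2) with hc
    have hc0 : 0 < c := by positivity
    obtain ⟨n, hn⟩ := 𝕋.mesh_to_zero ((1 / 2) ^ k / 4 / c) (by positivity)
    refine ⟨max n k, (1 / 2) ^ k / 4 / c, le_max_right _ _,
      fun s hs => (hn _ (le_max_left _ _) s hs).le, le_of_eq ?_⟩
    calc _ = (1 / 2) ^ k / 4 / c * c := by rw [hc]; ring
      _ = _ := div_mul_cancel₀ _ hc0.ne'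
  choose m δ h using h
  exact ⟨m, δ, h⟩

/-- Step functions with the required oscillation and quadratic variation up to level `N`. -/
theorem exists_approx (hT : 0 < T) (𝕋 : PartitionSeq T) {m : ℕ → ℕ} {δ : ℕ → ℝ}
    (hm : ∀ k, k ≤ m k ∧
      (∀ s ∈ 𝕋.part (m k), succOf T (𝕋.part (m k)) s - s ≤ δ k) ∧
      12 * δ k * T / tol k ^ 4 + (𝕋.part k).card * (16 * δ k * T / tol k ^ 2) ≤
        (1 / 2) ^ k / 4) (N : ℕ) :
    ∃ f : ℝ → ℝ, f 0 = 0 ∧ (∀ x ∈ Set.Icc 0 T, |f x| ≤ 4 * (T + 1)) ∧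
      (∀ k, m k ≤ N → ∀ s ∈ 𝕋.part (m k), s < T →
        ∀ x ∈ Set.Icc s (succOf T (𝕋.part (m k)) s), |f x - f s| ≤ tol k) ∧
      (∀ k, m k ≤ N → ∀ t ∈ 𝕋.part k, ∀ j, m k ≤ j → j ≤ N →
        |∑ s ∈ (𝕋.part j).filter (fun s => 0 ≤ s ∧ s < t),
          (f (succOf T (𝕋.part j) s) - f s) ^ 2 - 2 * t| ≤ tol k) := by
  classical
  set P := 𝕋.part N
  have hP : ∀ u ∈ P, u ≤ T := 𝕋.le_top
  have hTP : T ∈ P := 𝕋.top_mem N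
  have hsub : ∀ j, j ≤ N → 𝕋.part j ⊆ P := fun j hj => 𝕋.monotone_part hj
  set W := signWalk hTP hP
  set Ω := P → ℤˣ
  set n : ℝ := (Fintype.card Ω : ℝ)
  have hn0 : 0 < n := Nat.cast_pos.2 Fintype.card_pos
  set E : ℝ → ℝ → ℝ → Finset Ω := fun l a b => Finset.univ.filter
    (fun ω => ∃ d ∈ P.filter (fun d => a ≤ d ∧ d ≤ b), l ≤ |W.inc a d ω|)
  set G : ℕ → ℝ → Finset Ω := fun k t => Finset.univ.filter
    (fun ω => ∃ j ∈ Finset.Icc (m k) N, tol k ≤ |W.qvErr (𝕋.part j) t ω|)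
  set K := (Finset.range (N + 1)).filter (fun k => m k ≤ N)
  set Q : ℕ → Finset ℝ := fun k => (𝕋.part (m k)).filter (fun s => 0 ≤ s ∧ s < T)
  set D : ℕ → Finset Ω := fun k =>
    (Q k).biUnion (fun s => E (tol k) s (succOf T (𝕋.part (m k)) s)) ∪
      (𝕋.part k).biUnion (G k)
  have hE0 : ((E (4 * (T + 1)) 0 T).card : ℝ) ≤ n / 4 := by
    have h := W.card_exists_le_inc hTP hP (l := 4 * (T + 1)) (by positivity) (𝕋.zero_mem N)
      hTP hT.le
    have h2 : 12 * (T - 0) ^ 2 * n ≤ n / 4 * (4 * (T + 1)) ^ 4 := by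
      have : 12 * T ^ 2 ≤ (4 * (T + 1)) ^ 4 / 4 := by
        have h1 : T ^ 2 ≤ (T + 1) ^ 2 := by gcongr; linarith
        have h3 : 1 ≤ (T + 1) ^ 2 := by nlinarith
        have h4 : (T + 1) ^ 2 ≤ (T + 1) ^ 2 * (T + 1) ^ 2 := le_mul_of_one_le_left (by positivity) h3
        nlinarith
      nlinarith
    exact le_of_mul_le_mul_right (h.trans h2) (by positivity)
  have hD : ∀ k ∈ K, ((D k).card : ℝ) ≤ (1 / 2) ^ k / 4 * n := by
    intro k hk
    have hkN := (Finset.mem_filter.1 hk).2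
    obtain ⟨hkm, hδ, hsmall⟩ := hm k
    have hl := tol_pos k
    have hTm := 𝕋.top_mem (m k)
    have h1 : (((Q k).biUnion (fun s => E (tol k) s (succOf T (𝕋.part (m k)) s))).card : ℝ) ≤
        12 * δ k * T / tol k ^ 4 * n := by
      calc _ ≤ ∑ s ∈ Q k, ((E (tol k) s (succOf T (𝕋.part (m k)) s)).card : ℝ) := by
            exact_mod_cast Finset.card_biUnion_le
        _ ≤ ∑ s ∈ Q k, 12 * δ k / tol k ^ 4 * n * (succOf T (𝕋.part (m k)) s - s) := by
            refine Finset.sum_le_sum fun s hs => ?_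
            have hs := (Finset.mem_filter.1 hs).1
            have hle := le_succOf hTm 𝕋.le_top (𝕋.le_top s hs)
            have h := W.card_exists_le_inc hTP hP hl.le (hsub _ hkN hs)
              (hsub _ hkN (succOf_mem hTm 𝕋.le_top (𝕋.le_top s hs))) hle
            rw [← le_div_iff₀ (by positivity)] at h
            refine h.trans ?_
            have hd := hδ s hs
            have : (succOf T (𝕋.part (m k)) s - s) ^ 2 ≤
                δ k * (succOf T (𝕋.part (m k)) s - s) := by
              rw [pow_two]
              exact mul_le_mul_of_nonneg_right hd (sub_nonneg.2 hle)
            calc _ ≤ 12 * (δ k * (succOf T (𝕋.part (m k)) s - s)) * n / tol k ^ 4 := by gcongr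
              _ = _ := by ring
        _ = _ := by
            rw [← Finset.mul_sum, sum_succOf_sub hTm 𝕋.le_top (fun x => x) (𝕋.zero_mem _) hTm hT.le]
            ring
    have h2 : (((𝕋.part k).biUnion (G k)).card : ℝ) ≤
        (𝕋.part k).card * (16 * δ k * T / tol k ^ 2) * n := by
      calc _ ≤ ∑ t ∈ 𝕋.part k, ((G k t).card : ℝ) := by
            exact_mod_cast Finset.card_biUnion_le
        _ ≤ ∑ _t ∈ 𝕋.part k, 16 * δ k * T / tol k ^ 2 * n := by
            refine Finset.sum_le_sum fun t ht => ?_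
            have h := W.card_exists_le_qvErr hP 𝕋.monotone_part hTm hsub hkN hl.le
              (𝕋.zero_mem _) (𝕋.monotone_part hkm ht) (𝕋.nonneg ht) hδ
            rw [← le_div_iff₀ (by positivity)] at h
            exact h.trans_eq (by ring)
        _ = _ := by rw [Finset.sum_const, nsmul_eq_mul]; ring
    calc ((D k).card : ℝ) ≤ _ + _ := by exact_mod_cast Finset.card_union_le _ _
      _ ≤ _ := add_le_add h1 h2
      _ = _ * n := by rw [← add_mul]
      _ ≤ _ := by gcongr
  have hgeom : ∑ k ∈ K, ((D k).card : ℝ) ≤ n / 2 := by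
    calc _ ≤ ∑ k ∈ K, (1 / 2 : ℝ) ^ k / 4 * n := Finset.sum_le_sum hD
      _ ≤ ∑ k ∈ Finset.range (N + 1), (1 / 2 : ℝ) ^ k / 4 * n :=
          Finset.sum_le_sum_of_subset_of_nonneg (Finset.filter_subset _ _)
            fun _ _ _ => by positivity
      _ = (∑ k ∈ Finset.range (N + 1), (1 / 2 : ℝ) ^ k) / 4 * n := by
          rw [← Finset.sum_mul, Finset.sum_div]
      _ ≤ 2 / 4 * n := by
          have := sum_geometric_two_le (N + 1)
          gcongr
      _ = _ := by ring
  obtain ⟨ω, hω⟩ : ∃ ω, ω ∉ E (4 * (T + 1)) 0 T ∪ K.biUnion D := by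
    by_contra! hall
    have h1 : Fintype.card Ω ≤ (E (4 * (T + 1)) 0 T ∪ K.biUnion D).card := by
      rw [← Finset.card_univ]
      exact Finset.card_le_card fun ω _ => hall ω
    have h2 : n ≤ (E (4 * (T + 1)) 0 T).card + ∑ k ∈ K, ((D k).card : ℝ) := by
      have := Nat.cast_le (α := ℝ).2 (h1.trans ((Finset.card_union_le _ _).trans
        (Nat.add_le_add_left Finset.card_biUnion_le _)))
      push_cast at this
      exact this
    linarith
  rw [Finset.mem_union, not_or, Finset.mem_biUnion] at hω
  obtain ⟨hω0, hωK⟩ := hω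
  have hE : ∀ {l a b : ℝ}, ω ∉ E l a b → ∀ d ∈ P.filter (fun d => a ≤ d ∧ d ≤ b),
      |W.inc a d ω| < l := by
    intro l a b h d hd
    by_contra! hle
    exact h (Finset.mem_filter.2 ⟨Finset.mem_univ _, d, hd, hle⟩)
  have hK : ∀ k, m k ≤ N → ω ∉ D k := fun k hk h =>
    hωK ⟨k, Finset.mem_filter.2 ⟨Finset.mem_range.2 (by have := (hm k).1; omega), hk⟩, h⟩
  refine ⟨fun x => W.inc 0 x ω, W.inc_self 0 ω,
    fun x hx => (W.abs_inc_lt hTP (hE hω0) hx.1 hx.2).le, fun k hk s hs hsT x hx => ?_,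
    fun k hk t ht j hkj hjN => ?_⟩
  · have hs0 := 𝕋.nonneg hs
    rw [← W.inc_eq_sub hs0 hx.1]
    refine (W.abs_inc_lt (hsub _ hk (succOf_mem (𝕋.top_mem _) 𝕋.le_top hsT.le))
      (hE fun h => hK k hk ?_) hx.1 hx.2).le
    exact Finset.mem_union_left _
      (Finset.mem_biUnion.2 ⟨s, Finset.mem_filter.2 ⟨hs, hs0, hsT⟩, h⟩)
  · by_contra! hlt
    refine hK k hk (Finset.mem_union_right _ (Finset.mem_biUnion.2 ⟨t, ht, ?_⟩))
    refine Finset.mem_filter.2 ⟨Finset.mem_univ _, j, Finset.mem_Icc.2 ⟨hkj, hjN⟩, ?_⟩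
    rw [SignWalk.qvErr]
    refine hlt.le.trans_eq (congrArg abs (congrArg (fun y => y - 2 * t) ?_))
    refine Finset.sum_congr rfl fun s hs => ?_
    have hs := Finset.mem_filter.1 hs
    rw [W.inc_eq_sub hs.2.1 (le_succOf (𝕋.top_mem j) 𝕋.le_top (𝕋.le_top s hs.1))]


theorem exists_block_le_lt {Q : Finset ℝ} (hT : T ∈ Q) {y : ℝ} (h0 : 0 ∈ Q)
    (hy0 : 0 ≤ y) (hyT : y < T) : ∃ s ∈ Q, s ≤ y ∧ y < succOf T Q s := by
  obtain ⟨s, hs, hmax⟩ := Finset.exists_max_image (Q.filter (fun s => s ≤ y)) (fun s => s)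
    ⟨0, Finset.mem_filter.2 ⟨h0, hy0⟩⟩
  have hs := Finset.mem_filter.1 hs
  obtain ⟨h1, h2, -⟩ := succOf_spec hT (hs.2.trans_lt hyT)
  refine ⟨s, hs.1, hs.2, ?_⟩
  by_contra! h
  exact absurd (hmax _ (Finset.mem_filter.2 ⟨h2, h⟩)) (not_le.2 h1)

theorem exists_block {Q : Finset ℝ} (hT : T ∈ Q) (hT0 : 0 < T) {y : ℝ} (h0 : 0 ∈ Q)
    (hy0 : 0 ≤ y) (hyT : y ≤ T) : ∃ s ∈ Q, s < T ∧ s ≤ y ∧ y ≤ succOf T Q s := by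
  rcases hy0.eq_or_lt with rfl | hy0
  · exact ⟨0, h0, hT0, le_rfl, (succOf_spec hT hT0).1.le⟩
  obtain ⟨s, hs, hmax⟩ := Finset.exists_max_image (Q.filter (fun s => s < y)) (fun s => s)
    ⟨0, Finset.mem_filter.2 ⟨h0, hy0⟩⟩
  have hs := Finset.mem_filter.1 hs
  obtain ⟨h1, h2, -⟩ := succOf_spec hT (hs.2.trans_le hyT)
  refine ⟨s, hs.1, hs.2.trans_le hyT, hs.2.le, ?_⟩
  by_contra! h
  exact absurd (hmax _ (Finset.mem_filter.2 ⟨h2, h⟩)) (not_le.2 h1)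

theorem exists_limit (hT : 0 < T) (𝕋 : PartitionSeq T) :
    ∃ (m : ℕ → ℕ) (S : ℝ → ℝ), S 0 = 0 ∧
      (∀ k, ∀ s ∈ 𝕋.part (m k), s < T →
        ∀ x ∈ Set.Icc s (succOf T (𝕋.part (m k)) s), |S x - S s| ≤ tol k) ∧
      (∀ k, ∀ t ∈ 𝕋.part k, ∀ j, m k ≤ j →
        |∑ s ∈ (𝕋.part j).filter (fun s => 0 ≤ s ∧ s < t),
          (S (succOf T (𝕋.part j) s) - S s) ^ 2 - 2 * t| ≤ tol k) := by
  obtain ⟨m, δ, hm⟩ := 𝕋.exists_levels hT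
  choose f hf0 hfC hfosc hfqv using 𝕋.exists_approx hT hm
  have hlim : ∀ x, ∃ l, x ∈ Set.Icc 0 T →
      Tendsto (fun N => f N x) (Filter.hyperfilter ℕ : Filter ℕ) (𝓝 l) := by
    intro x
    by_cases hx : x ∈ Set.Icc 0 T
    · have hC : ∀ N, f N x ∈ Set.Icc (-(4 * (T + 1))) (4 * (T + 1)) := fun N =>
        abs_le.1 (hfC N x hx)
      obtain ⟨l, -, hl⟩ := isCompact_Icc.ultrafilter_le_nhds'
        ((Filter.hyperfilter ℕ).map fun N => f N x)
        (Filter.mem_map.2 (Filter.univ_mem' hC))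
      exact ⟨l, fun _ => hl⟩
    · exact ⟨0, fun h => absurd h hx⟩
  choose S hS using hlim
  have hev : ∀ k, ∀ᶠ N in (Filter.hyperfilter ℕ : Filter ℕ), k ≤ N := fun k =>
    Nat.hyperfilter_le_atTop (Filter.eventually_ge_atTop k)
  have hmem : ∀ j, ∀ s ∈ 𝕋.part j, s ∈ Set.Icc 0 T := fun j s hs => 𝕋.subset_Icc j hs
  have hsucc : ∀ j, ∀ s ∈ 𝕋.part j, succOf T (𝕋.part j) s ∈ Set.Icc 0 T := fun j s hs =>
    hmem j _ (succOf_mem (𝕋.top_mem j) 𝕋.le_top (𝕋.le_top s hs))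
  refine ⟨m, S, ?_, fun k s hs hsT x hx => ?_, fun k t ht j hkj => ?_⟩
  · have h := hS 0 ⟨le_rfl, hT.le⟩
    simp only [hf0] at h
    exact tendsto_nhds_unique h tendsto_const_nhds
  · have hx' : x ∈ Set.Icc 0 T := ⟨(𝕋.nonneg hs).trans hx.1, hx.2.trans (hsucc _ s hs).2⟩
    refine le_of_tendsto ((hS x hx').sub (hS s (hmem _ s hs))).abs ?_
    filter_upwards [hev (m k)] with N hN using hfosc N k hN s hs hsT x hx
  · have hterm : Tendsto (fun N => ∑ s ∈ (𝕋.part j).filter (fun s => 0 ≤ s ∧ s < t),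
          (f N (succOf T (𝕋.part j) s) - f N s) ^ 2) (Filter.hyperfilter ℕ : Filter ℕ)
        (𝓝 (∑ s ∈ (𝕋.part j).filter (fun s => 0 ≤ s ∧ s < t),
          (S (succOf T (𝕋.part j) s) - S s) ^ 2)) := by
      refine tendsto_finsetSum _ fun s hs => ?_
      have hs := (Finset.mem_filter.1 hs).1
      exact ((hS _ (hsucc j s hs)).sub (hS s (hmem j s hs))).pow 2
    refine le_of_tendsto (hterm.sub_const (2 * t)).abs ?_
    filter_upwards [hev (m k), hev j] with N hN hjN using hfqv N k hN t ht j hkj hjN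

theorem exists_tol_lt {ε : ℝ} (hε : 0 < ε) : ∃ k₀, ∀ k, k₀ ≤ k → tol k < ε := by
  obtain ⟨k₀, hk₀⟩ := exists_nat_one_div_lt hε
  exact ⟨k₀, fun k hk => (Nat.one_div_le_one_div hk).trans_lt hk₀⟩

theorem continuousOn_of_osc (hT : 0 < T) (𝕋 : PartitionSeq T) {m : ℕ → ℕ} {S : ℝ → ℝ}
    (hosc : ∀ k, ∀ s ∈ 𝕋.part (m k), s < T →
      ∀ x ∈ Set.Icc s (succOf T (𝕋.part (m k)) s), |S x - S s| ≤ tol k) :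
    ContinuousOn S (Set.Icc 0 T) := by
  intro x _
  rw [Metric.continuousWithinAt_iff']
  intro ε hε
  obtain ⟨k, hk⟩ := exists_tol_lt (half_pos hε)
  have hk := hk k le_rfl
  set Q := 𝕋.part (m k)
  set F : Set ℝ := ⋃ s ∈ Q.filter (fun s => x ∉ Set.Icc s (succOf T Q s)),
    Set.Icc s (succOf T Q s)
  have hF : IsClosed F := isClosed_biUnion_finset fun s _ => isClosed_Icc
  have hxF : x ∉ F := by
    simp only [F, Set.mem_iUnion, not_exists]
    exact fun s hs => (Finset.mem_filter.1 hs).2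
  filter_upwards [mem_nhdsWithin_of_mem_nhds (hF.isOpen_compl.mem_nhds hxF), self_mem_nhdsWithin]
    with y hyF hy
  obtain ⟨s, hs, hsT, hsy, hys⟩ := exists_block (𝕋.top_mem (m k)) hT (𝕋.zero_mem _) hy.1 hy.2
  have hxs : x ∈ Set.Icc s (succOf T Q s) := by
    by_contra hxs
    exact hyF (Set.mem_biUnion (show s ∈ (Q.filter fun s => x ∉ Set.Icc s (succOf T Q s)) from
      Finset.mem_filter.2 ⟨hs, hxs⟩) ⟨hsy, hys⟩)
  have h1 := hosc k s hs hsT y ⟨hsy, hys⟩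
  have h2 := hosc k s hs hsT x hxs
  rw [Real.dist_eq]
  calc |S y - S x| ≤ |S y - S s| + |S x - S s| := by
        rw [abs_sub_comm (S x)]
        exact abs_sub_le _ _ _
    _ < ε := by linarith

theorem tendsto_sum_sq (hT : 0 < T) (𝕋 : PartitionSeq T) {m : ℕ → ℕ} {S : ℝ → ℝ}
    (hqv : ∀ k, ∀ t ∈ 𝕋.part k, ∀ j, m k ≤ j →
        |∑ s ∈ (𝕋.part j).filter (fun s => 0 ≤ s ∧ s < t),
          (S (succOf T (𝕋.part j) s) - S s) ^ 2 - 2 * t| ≤ tol k)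
    {t : ℝ} (ht : t ∈ Set.Icc 0 T) :
    Tendsto (fun n => ∑ s ∈ (𝕋.part n).filter (fun s => s ≤ t),
      (S (succOf T (𝕋.part n) s) - S s) ^ 2) atTop (𝓝 (2 * t)) := by
  rw [Metric.tendsto_atTop]
  intro ε hε
  obtain ⟨k₀, hk₀⟩ := exists_tol_lt (show 0 < ε / 3 by linarith)
  obtain ⟨k₁, hk₁⟩ := 𝕋.mesh_to_zero (ε / 3) (by linarith)
  set k := max k₀ k₁
  have htol := hk₀ k (le_max_left _ _)
  have hmesh := hk₁ k (le_max_right _ _)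
  obtain ⟨a, b, ha, hb, hat, htb, hba, hlt⟩ : ∃ a b, a ∈ 𝕋.part k ∧ b ∈ 𝕋.part k ∧ a ≤ t ∧ t ≤ b ∧
      b - a < ε / 3 ∧ (t < b ∨ t = T) := by
    rcases ht.2.eq_or_lt with rfl | htT
    · exact ⟨t, t, 𝕋.top_mem k, 𝕋.top_mem k, le_rfl, le_rfl, by linarith, Or.inr rfl⟩
    · obtain ⟨a, ha, hat, htb⟩ := exists_block_le_lt (𝕋.top_mem k) (𝕋.zero_mem k) ht.1 htT
      exact ⟨a, _, ha, succOf_mem (𝕋.top_mem k) 𝕋.le_top (𝕋.le_top a ha), hat, htb.le,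
        hmesh a ha, Or.inl htb⟩
  refine ⟨m k, fun j hj => ?_⟩
  have h1 := abs_le.1 (hqv k a ha j hj)
  have h2 := abs_le.1 (hqv k b hb j hj)
  have hlow : ∑ s ∈ (𝕋.part j).filter (fun s => 0 ≤ s ∧ s < a),
      (S (succOf T (𝕋.part j) s) - S s) ^ 2 ≤ ∑ s ∈ (𝕋.part j).filter (fun s => s ≤ t),
      (S (succOf T (𝕋.part j) s) - S s) ^ 2 := by
    refine Finset.sum_le_sum_of_subset_of_nonneg (fun s hs => ?_) fun _ _ _ => sq_nonneg _
    have hs := Finset.mem_filter.1 hs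
    exact Finset.mem_filter.2 ⟨hs.1, hs.2.2.le.trans hat⟩
  have hup : ∑ s ∈ (𝕋.part j).filter (fun s => s ≤ t),
      (S (succOf T (𝕋.part j) s) - S s) ^ 2 ≤
      ∑ s ∈ (𝕋.part j).filter (fun s => 0 ≤ s ∧ s < b),
      (S (succOf T (𝕋.part j) s) - S s) ^ 2 := by
    have hsub : (𝕋.part j).filter (fun s => 0 ≤ s ∧ s < b) ⊆
        insert T ((𝕋.part j).filter (fun s => 0 ≤ s ∧ s < b)) := Finset.subset_insert _ _
    rw [Finset.sum_subset hsub fun s hs hs' => ?_]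
    · refine Finset.sum_le_sum_of_subset_of_nonneg (fun s hs => ?_) fun _ _ _ => sq_nonneg _
      have hs := Finset.mem_filter.1 hs
      rcases hlt with hlt | rfl
      · exact Finset.mem_insert_of_mem
          (Finset.mem_filter.2 ⟨hs.1, 𝕋.nonneg hs.1, hs.2.trans_lt hlt⟩)
      · rcases hs.2.eq_or_lt with rfl | hst
        · exact Finset.mem_insert_self _ _
        · exact Finset.mem_insert_of_mem
            (Finset.mem_filter.2 ⟨hs.1, 𝕋.nonneg hs.1, hst.trans_le htb⟩)
    · rcases Finset.mem_insert.1 hs with rfl | h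
      · rw [succOf_top 𝕋.le_top, sub_self, zero_pow two_ne_zero]
      · exact absurd h hs'
  rw [Real.dist_eq, abs_lt]
  constructor <;> linarith

theorem sum_succOf_sub_le (hT : 0 < T) (𝕋 : PartitionSeq T) (n : ℕ) (t : ℝ) :
    ∑ s ∈ (𝕋.part n).filter (fun s => s ≤ t), (succOf T (𝕋.part n) s - s) ≤ T := by
  have h := sum_succOf_sub (𝕋.top_mem n) 𝕋.le_top (fun x => x) (𝕋.zero_mem n) (𝕋.top_mem n) hT.le
  rw [sub_zero] at h
  have hne : ∀ s ∈ 𝕋.part n, succOf T (𝕋.part n) s - s ≠ 0 → 0 ≤ s ∧ s < T := by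
    refine fun s hs hne => ⟨𝕋.nonneg hs, lt_of_le_of_ne (𝕋.le_top s hs) ?_⟩
    rintro rfl
    exact hne (by rw [succOf_top 𝕋.le_top, sub_self])
  rw [Finset.sum_filter_of_ne hne] at h
  refine le_of_le_of_eq ?_ h
  refine Finset.sum_le_sum_of_subset_of_nonneg (Finset.filter_subset _ _) fun s hs _ => ?_
  exact sub_nonneg.2 (le_succOf (𝕋.top_mem n) 𝕋.le_top (𝕋.le_top s hs))

/-- Continuous functions have zero covariation with time. -/
theorem tendsto_sum_mul_sub (hT : 0 < T) (𝕋 : PartitionSeq T) {h : ℝ → ℝ}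
    (hh : ContinuousOn h (Set.Icc 0 T)) (t : ℝ) :
    Tendsto (fun n => ∑ s ∈ (𝕋.part n).filter (fun s => s ≤ t),
      (h (succOf T (𝕋.part n) s) - h s) * (succOf T (𝕋.part n) s - s)) atTop (𝓝 0) := by
  rw [Metric.tendsto_atTop]
  intro ε hε
  obtain ⟨δ, hδ, hunif⟩ := Metric.uniformContinuousOn_iff.1
    (isCompact_Icc.uniformContinuousOn_of_continuous hh) (ε / (2 * T)) (by positivity)
  obtain ⟨N, hN⟩ := 𝕋.mesh_to_zero δ hδ
  refine ⟨N, fun n hn => ?_⟩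
  rw [Real.dist_eq, sub_zero]
  calc _ ≤ ∑ s ∈ (𝕋.part n).filter (fun s => s ≤ t),
        |(h (succOf T (𝕋.part n) s) - h s) * (succOf T (𝕋.part n) s - s)| :=
        Finset.abs_sum_le_sum_abs _ _
    _ ≤ ∑ s ∈ (𝕋.part n).filter (fun s => s ≤ t),
        ε / (2 * T) * (succOf T (𝕋.part n) s - s) := by
        refine Finset.sum_le_sum fun s hs => ?_
        have hs := (Finset.mem_filter.1 hs).1
        have hle := sub_nonneg.2 (le_succOf (𝕋.top_mem n) 𝕋.le_top (𝕋.le_top s hs))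
        rw [abs_mul, abs_of_nonneg hle]
        refine mul_le_mul_of_nonneg_right ?_ hle
        refine (hunif _ (𝕋.subset_Icc n (succOf_mem (𝕋.top_mem n) 𝕋.le_top (𝕋.le_top s hs)))
          _ (𝕋.subset_Icc n hs) ?_).le
        rw [Real.dist_eq, abs_of_nonneg hle]
        exact hN n hn s hs
    _ ≤ ε / (2 * T) * T := by
        rw [← Finset.mul_sum]
        exact mul_le_mul_of_nonneg_left (𝕋.sum_succOf_sub_le hT n t) (by positivity)
    _ < ε := by
        rw [div_mul_eq_mul_div, mul_div_mul_right _ _ hT.ne']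
        linarith

/-- A continuous path started at `0` with quadratic variation `2 t` and a prescribed value. -/
theorem exists_path (hT : 0 < T) (𝕋 : PartitionSeq T) {T₀ : ℝ} (hT₀ : T₀ ≠ 0) (x₀ : ℝ) :
    ∃ S : ℝ → ℝ, S 0 = 0 ∧ S T₀ = x₀ ∧ ContinuousOn S (Set.Icc 0 T) ∧
      ∀ t ∈ Set.Icc (0 : ℝ) T,
        Tendsto (fun n => ∑ s ∈ (𝕋.part n).filter (fun s => s ≤ t),
          (S (succOf T (𝕋.part n) s) - S s) ^ 2) atTop (𝓝 (2 * t)) := by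
  obtain ⟨m, S, hS0, hosc, hqv⟩ := 𝕋.exists_limit hT
  have hcont := 𝕋.continuousOn_of_osc hT hosc
  set c := (x₀ - S T₀) / T₀
  refine ⟨fun t => S t + c * t, by simp [hS0], ?_, hcont.add (by fun_prop), fun t ht => ?_⟩
  · simp only [c, div_mul_cancel₀ _ hT₀, add_sub_cancel]
  · have h := (𝕋.tendsto_sum_sq hT hqv ht).add (𝕋.tendsto_sum_mul_sub hT
      (h := fun u => 2 * c * S u + c ^ 2 * u) ((hcont.const_mul _).add (by fun_prop)) t)
    rw [add_zero] at h
    refine h.congr fun n => ?_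
    rw [← Finset.sum_add_distrib]
    exact Finset.sum_congr rfl fun s _ => by ring

end PartitionSeq

theorem differentiable_nullSol_sub (T : ℝ) :
    Differentiable ℝ (fun p : ℝ × ℝ => nullSol (T - p.1) p.2) := by
  have hsub : Differentiable ℝ (fun p : ℝ × ℝ => (T - p.1, p.2)) := by fun_prop
  have h := Differentiable.comp (𝕜 := ℝ) (g := fun p : ℝ × ℝ => nullSol p.1 p.2)
    differentiable_nullSol hsub
  exact h

theorem isC12s_nullSol (T : ℝ) (I : Set ℝ) : IsC12s I (fun t x => nullSol (T - t) x) := by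
  have htime : ∀ t x, HasDerivAt (fun τ => nullSol (T - τ) x)
      (-(2 * Complex.I * ((1 + Complex.I) * nullWave 3 (T - t, x))).re) t := fun t x => by
    have h := (hasDerivAt_nullSol_time (T - t) x).comp t ((hasDerivAt_id t).const_sub T)
    exact h.congr_deriv (by ring)
  have hdiff := differentiable_nullSol_sub T
  have hw : ∀ k, Continuous fun p : ℝ × ℝ => nullWave k (T - p.1, p.2) := fun k =>
    (continuous_nullWave k).comp (by fun_prop)
  refine ⟨hdiff.continuous.continuousOn, fun t _ x => hdiff (t, x),
    fun t _ x => (hasDerivAt_deriv_nullSol (T - t) x).differentiableAt, ?_⟩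
  refine ⟨fun p => -(2 * Complex.I * ((1 + Complex.I) * nullWave 3 (T - p.1, p.2))).re,
    fun p => (2 * Complex.I * nullWave 2 (T - p.1, p.2)).re,
    fun p => (2 * Complex.I * ((1 + Complex.I) * nullWave 3 (T - p.1, p.2))).re,
    ?_, ?_, ?_, fun t _ x => ⟨?_, ?_, ?_⟩⟩
  · exact (Complex.continuous_re.comp
      (continuous_const.mul (continuous_const.mul (hw 3)))).neg.continuousOn
  · exact (Complex.continuous_re.comp (continuous_const.mul (hw 2))).continuousOn
  · exact (Complex.continuous_re.comp
      (continuous_const.mul (continuous_const.mul (hw 3)))).continuousOn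
  · exact (htime t x).deriv.symm
  · exact (hasDerivAt_nullSol_space (T - t) x).deriv.symm
  · exact (hasDerivAt_deriv_nullSol (T - t) x).deriv.symm

/-- Example 3.4: for `d = 1` and `a ≡ 2` there is a non-admissible arbitrage opportunity:
a nonzero solution `v` of the time-reversed heat equation with terminal condition `0`,
a path `S ∈ 𝒮_a` (i.e. `⟨S,S⟩(t) = 2t`), and a time `T₀` with `v(0,S(0)) = 0` and
`v(T₀,S(T₀)) > 0`; so with `V^S(t) := v(t,S(t))`, conditions (a) and (b) of the definition
of an arbitrage opportunity hold. -/
theorem stmt18 :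
    ∃ T : ℝ, 0 < T ∧ ∀ 𝕋 : PartitionSeq T,
      ∃ (v : ℝ → ℝ → ℝ) (S : ℝ → ℝ) (T₀ : ℝ),
        -- `v` solves the time-reversed heat equation with terminal condition `0`
        IsC12s (Set.Ico 0 T) v ∧
        ContinuousOn (fun p : ℝ × ℝ => v p.1 p.2) (Set.Icc 0 T ×ˢ (Set.univ : Set ℝ)) ∧
        (∀ t ∈ Set.Ico (0 : ℝ) T, ∀ x : ℝ,
          derivWithin (fun τ => v τ x) (Set.Icc 0 T) t + deriv (deriv (v t)) x = 0) ∧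
        (∀ x : ℝ, v T x = 0) ∧
        -- `S ∈ 𝒮_a` for `a ≡ 2`
        ContinuousOn S (Set.Icc 0 T) ∧
        (∀ t ∈ Set.Icc (0 : ℝ) T,
          Tendsto (fun n => ∑ s ∈ (𝕋.part n).filter (fun s => s ≤ t),
            (S (succOf T (𝕋.part n) s) - S s) ^ 2) atTop (𝓝 (2 * t))) ∧
        -- conditions (a) and (b) of an arbitrage opportunity hold for `V^S(t) = v(t,S(t))`
        T₀ ∈ Set.Ioc (0 : ℝ) T ∧ v 0 (S 0) = 0 ∧ 0 < v T₀ (S T₀) := by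
  obtain ⟨τ, x₀, hτ, hpos⟩ := exists_nullSol_pos
  have hT : 0 < 2 * τ := by linarith
  refine ⟨2 * τ, hT, fun 𝕋 => ?_⟩
  obtain ⟨S, hS0, hSτ, hcont, hqv⟩ := 𝕋.exists_path hT hτ.ne' x₀
  have hv := isC12s_nullSol (2 * τ)
  refine ⟨fun t x => nullSol (2 * τ - t) x, S, τ, hv _, (hv _).cont, fun t ht x => ?_,
    fun x => ?_, hcont, hqv, ⟨hτ, by linarith⟩, ?_, ?_⟩
  · have h := (hasDerivAt_nullSol_time (2 * τ - t) x).comp t ((hasDerivAt_id t).const_sub (2 * τ))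
    have hd := h.hasDerivWithinAt.derivWithin (s := Set.Icc 0 (2 * τ))
      (uniqueDiffOn_Icc hT t ⟨ht.1, ht.2.le⟩)
    have hxx := (hasDerivAt_deriv_nullSol (2 * τ - t) x).deriv
    refine (congrArg₂ (· + ·) hd hxx).trans ?_
    ring
  · simp only [sub_self, nullSol_zero]
  · have h := nullSol_neg (2 * τ - 0) 0
    rw [neg_zero] at h
    simp only [hS0]
    linarith
  · simpa only [hSτ, show 2 * τ - τ = τ by ring] using hpos
end
end
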